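/- arXiv:2308.10480 — 6 statements merged into one kernel-verified Lean document; each statement's English description precedes it below -/
import Mathlib

section
/- Let C₁, …, Cₙ be convex sets in ℝ^d with n ≥ 2, let r ∈ {1, …, n}, and let b ∈ ℝ^d. If the closed unit ball B(b,1) intersects the intersection ⋂_{j∈J} C_j for every subset J ⊆ {1, …, n} with |J| = r, then there exists a point q ∈ ℝ^d such that for all i ∈ {1, …, n} one has d(q, C_i) ≤ √((n − r)/(r(n − 1))). -/
open Metric Filter

section Caratheodory

variable {E ι : Type*} [NormedAddCommGroup E] [InnerProductSpace ℝ E] [Fintype ι]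

theorem le_norm_sq_of_nonpos_coord {a : ι → E} {β : ι → ℝ} (hβ : ∀ i, 0 < β i)
    (hβ1 : ∑ i, β i = 1) (hβ0 : ∑ i, β i • a i = 0) {H : ℝ}
    (hH : ∀ c ∈ stdSimplex ℝ ι, (∃ i, c i = 0) → H ≤ ‖∑ i, c i • a i‖ ^ 2)
    {c : ι → ℝ} (hc1 : ∑ i, c i = 1) (hc : ∃ i, c i ≤ 0) :
    H ≤ ‖∑ i, c i • a i‖ ^ 2 := by
  classical
  obtain ⟨i₀, hi₀⟩ := hc
  obtain ⟨k, hk, hmin⟩ := Finset.exists_min_image (Finset.univ.filter fun i => c i ≤ 0)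
    (fun i => β i / (β i - c i)) ⟨i₀, by simpa using hi₀⟩
  replace hk : c k ≤ 0 := by simpa using hk
  have hkpos : 0 < β k - c k := by linarith [hβ k]
  set t := β k / (β k - c k) with ht
  have ht0 : 0 ≤ t := div_nonneg (hβ k).le hkpos.le
  have ht1 : t ≤ 1 := (div_le_one hkpos).2 (by linarith)
  have hmem : (fun i => (1 - t) * β i + t * c i) ∈ stdSimplex ℝ ι := by
    refine ⟨fun i => ?_, ?_⟩
    · by_cases hi : c i ≤ 0
      · have h1 := hmin i (by simpa using hi)
        rw [le_div_iff₀ (by linarith [hβ i])] at h1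
        change 0 ≤ (1 - t) * β i + t * c i
        linarith
      · have := (hβ i).le
        push Not at hi
        have h2 : 0 ≤ 1 - t := by linarith
        positivity
    · rw [Finset.sum_add_distrib, ← Finset.mul_sum, ← Finset.mul_sum, hβ1, hc1]
      ring
  have hzero : (1 - t) * β k + t * c k = 0 := by
    rw [ht]
    field_simp
    ring
  have h := hH _ hmem ⟨k, hzero⟩
  have hsum : ∑ i, ((1 - t) * β i + t * c i) • a i = t • ∑ i, c i • a i := by
    simp_rw [add_smul, mul_smul]
    rw [Finset.sum_add_distrib, ← Finset.smul_sum, ← Finset.smul_sum, hβ0, smul_zero, zero_add]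
  rw [hsum, norm_smul, mul_pow, Real.norm_eq_abs, sq_abs] at h
  nlinarith [sq_nonneg ‖∑ i, c i • a i‖, mul_le_one₀ ht1 ht0 ht1]

theorem sq_mul_sub_le_sum_of_boundary_le [DecidableEq ι] {a : ι → E} {β : ι → ℝ}
    (hβ : ∀ i, 0 < β i)
    (hβ1 : ∑ i, β i = 1) (hβ0 : ∑ i, β i • a i = 0) {H : ℝ}
    (hH : ∀ c ∈ stdSimplex ℝ ι, (∃ i, c i = 0) → H ≤ ‖∑ i, c i • a i‖ ^ 2)
    {α : ι → ℝ} (hα : α ∈ stdSimplex ℝ ι) :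
    ((Fintype.card ι : ℝ) - 1) ^ 2 * (H - ‖∑ i, α i • a i‖ ^ 2) ≤
      ∑ i, α i * ‖a i - ∑ j, α j • a j‖ ^ 2 := by
  have hα0 : ∀ i, 0 ≤ α i := hα.1
  have hα1 : ∑ i, α i = 1 := hα.2
  set p := ∑ i, α i • a i with hp
  have hV : 0 ≤ ∑ i, α i * ‖a i - p‖ ^ 2 :=
    Finset.sum_nonneg fun i _ => mul_nonneg (hα0 i) (sq_nonneg _)
  rcases le_or_gt H (‖p‖ ^ 2) with hHp | hHp
  · nlinarith [sq_nonneg ((Fintype.card ι : ℝ) - 1)]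
  have hHpos : 0 < H := lt_of_le_of_lt (sq_nonneg _) hHp
  have hout := fun (c : ι → ℝ) => le_norm_sq_of_nonpos_coord (c := c) hβ hβ1 hβ0 hH
  have h1 : ∀ i, H * (1 - α i / β i) ^ 2 ≤ ‖p‖ ^ 2 := by
    intro i
    rcases eq_or_ne (1 - α i / β i) 0 with hx | hx
    · rw [hx]; simp
    have hb := (hβ i).ne'
    have h := hout (fun j => β j + (1 - α i / β i)⁻¹ * (α j - β j))
      (by rw [Finset.sum_add_distrib, ← Finset.mul_sum, Finset.sum_sub_distrib, hα1, hβ1]; ring)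
      ⟨i, by
        have : α i - β i = -(1 - α i / β i) * β i := by field_simp; ring
        rw [this, ← mul_assoc, mul_neg, inv_mul_cancel₀ hx]; linarith⟩
    have hsum : ∑ j, (β j + (1 - α i / β i)⁻¹ * (α j - β j)) • a j
        = (1 - α i / β i)⁻¹ • p := by
      simp_rw [add_smul, mul_smul, sub_smul, smul_sub]
      rw [Finset.sum_add_distrib, Finset.sum_sub_distrib, ← Finset.smul_sum, ← Finset.smul_sum,
        hβ0, smul_zero, zero_add, sub_zero]
    rw [hsum, norm_smul, mul_pow, Real.norm_eq_abs, sq_abs, inv_pow, inv_mul_eq_div,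
      le_div_iff₀ (by positivity)] at h
    exact h
  have h2 : ∀ i, H * (1 - α i) ^ 2 ≤ β i ^ 2 * ‖a i - p‖ ^ 2 := by
    intro i
    rcases eq_or_ne (1 - α i) 0 with hx | hx
    · rw [hx]; simp; positivity
    have h := hout (fun j => β j + (β i / (1 - α i)) * (α j - Pi.single (M := fun _ => ℝ) i 1 j))
      (by rw [Finset.sum_add_distrib, ← Finset.mul_sum, Finset.sum_sub_distrib, hα1, hβ1,
            Finset.sum_pi_single']; simp)
      ⟨i, by
        have : α i - 1 = -(1 - α i) := by ring
        simp only [Pi.single_eq_same]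
        rw [this, mul_neg, div_mul_cancel₀ _ hx]; linarith⟩
    have hsum : ∑ j, (β j + (β i / (1 - α i)) * (α j - Pi.single (M := fun _ => ℝ) i 1 j)) • a j
        = -((β i / (1 - α i)) • (a i - p)) := by
      simp_rw [add_smul, mul_smul, sub_smul, smul_sub]
      rw [Finset.sum_add_distrib, Finset.sum_sub_distrib, ← Finset.smul_sum, ← Finset.smul_sum,
        hβ0, zero_add]
      simp [Pi.single_apply, hp]
    rw [hsum, norm_neg, norm_smul, mul_pow, Real.norm_eq_abs, sq_abs, div_pow, div_mul_eq_mul_div,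
      le_div_iff₀ (by positivity)] at h
    exact h
  set M := (Fintype.card ι : ℝ) - 1 with hM
  set G := H - ‖p‖ ^ 2 with hG
  have hGpos : 0 < G := by linarith
  have hpt : ∀ i, 2 * M * G * (1 - α i) - M ^ 2 * G * (2 * β i - α i) ≤
      α i * ‖a i - p‖ ^ 2 := by
    intro i
    have hb := hβ i
    obtain ⟨x, hx⟩ : ∃ x, x = α i / β i := ⟨_, rfl⟩
    have hαx : α i = x * β i := by rw [hx]; field_simp
    have h1i := h1 i
    have h2i := h2 i
    rw [← hx] at h1i
    have hx0 : 0 ≤ x := by rw [hx]; exact div_nonneg (hα0 i) hb.le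
    have hxpos : 0 < x := by
      rcases hx0.eq_or_lt with h0 | h0
      · rw [← h0] at h1i; nlinarith
      · exact h0
    have hA : G ≤ H * (x * (2 - x)) := by nlinarith
    have hd : H * (1 - α i) ^ 2 / β i ^ 2 ≤ ‖a i - p‖ ^ 2 := by
      rw [div_le_iff₀ (by positivity)]; linarith
    have hB : x * (H * (1 - α i) ^ 2 / β i) ≤ α i * ‖a i - p‖ ^ 2 := by
      calc x * (H * (1 - α i) ^ 2 / β i) = (x * β i) * (H * (1 - α i) ^ 2 / β i ^ 2) := by
            field_simp
        _ ≤ _ := by rw [← hαx]; exact mul_le_mul_of_nonneg_left hd (hα0 i)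
    have hC : 2 * M * G * (1 - α i) - M ^ 2 * G ^ 2 * β i / (x * H)
        ≤ x * (H * (1 - α i) ^ 2 / β i) := by
      have : x * (H * (1 - α i) ^ 2 / β i)
          - (2 * M * G * (1 - α i) - M ^ 2 * G ^ 2 * β i / (x * H))
          = (x * H * (1 - α i) - M * G * β i) ^ 2 / (x * H * β i) := by
        field_simp
        ring
      have h0 : 0 ≤ (x * H * (1 - α i) - M * G * β i) ^ 2 / (x * H * β i) := by positivity
      linarith
    have hD : M ^ 2 * G ^ 2 * β i / (x * H) ≤ M ^ 2 * G * (2 * β i - α i) := by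
      rw [div_le_iff₀ (by positivity)]
      have : 0 ≤ M ^ 2 * G * β i := by positivity
      rw [hαx]
      nlinarith
    linarith
  have hs := Finset.sum_le_sum fun i (_ : i ∈ Finset.univ) => hpt i
  rw [Finset.sum_sub_distrib, ← Finset.mul_sum, ← Finset.mul_sum, Finset.sum_sub_distrib,
    Finset.sum_sub_distrib, ← Finset.mul_sum, hα1, hβ1, Finset.sum_const, Finset.card_univ,
    nsmul_eq_mul, mul_one, ← hM] at hs
  linarith

theorem sum_mul_norm_sub_sq {a : ι → E} {α : ι → ℝ} (hα1 : ∑ i, α i = 1) (b : E) :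
    ∑ i, α i * ‖a i - b‖ ^ 2 = ∑ i, α i * ‖a i‖ ^ 2 - ‖∑ i, α i • a i‖ ^ 2
      + ‖(∑ i, α i • a i) - b‖ ^ 2 := by
  have h : ∀ i, α i * ‖a i - b‖ ^ 2
      = α i * ‖a i‖ ^ 2 - 2 * inner ℝ (α i • a i) b + α i * ‖b‖ ^ 2 := by
    intro i
    rw [norm_sub_sq_real, real_inner_smul_left]; ring
  simp_rw [h]
  rw [Finset.sum_add_distrib, Finset.sum_sub_distrib, ← Finset.mul_sum, ← sum_inner,
    ← Finset.sum_mul, hα1, norm_sub_sq_real]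
  ring

theorem norm_sq_add_eq_of_isMinOn_of_pos {a : ι → E} {l β : ι → ℝ} (hβ : ∀ i, 0 < β i)
    (hβ1 : ∑ i, β i = 1)
    (hmin : ∀ c ∈ stdSimplex ℝ ι,
      ‖∑ i, β i • a i‖ ^ 2 + ∑ i, β i * l i ≤ ‖∑ i, c i • a i‖ ^ 2 + ∑ i, c i * l i)
    {c : ι → ℝ} (hc1 : ∑ i, c i = 1) :
    ‖∑ i, c i • a i‖ ^ 2 + ∑ i, c i * l i =
      ‖∑ i, β i • a i‖ ^ 2 + ∑ i, β i * l i
        + ‖(∑ i, c i • a i) - ∑ i, β i • a i‖ ^ 2 := by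
  set x := ∑ i, β i • a i with hx
  set y := ∑ i, c i • a i with hy
  set D := 2 * inner ℝ x (y - x) + (∑ i, c i * l i - ∑ i, β i * l i) with hD
  have hf : ∀ t : ℝ, ‖∑ i, (β i + t * (c i - β i)) • a i‖ ^ 2
      + ∑ i, (β i + t * (c i - β i)) * l i
      = ‖x‖ ^ 2 + ∑ i, β i * l i + (t * D + t ^ 2 * ‖y - x‖ ^ 2) := by
    intro t
    have e1 : ∑ i, (β i + t * (c i - β i)) • a i = x + t • (y - x) := by
      simp_rw [add_smul, mul_smul, sub_smul]
      rw [Finset.sum_add_distrib, ← Finset.smul_sum, Finset.sum_sub_distrib]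
    have e2 : ∑ i, (β i + t * (c i - β i)) * l i
        = ∑ i, β i * l i + t * (∑ i, c i * l i - ∑ i, β i * l i) := by
      simp_rw [add_mul, mul_assoc, sub_mul]
      rw [Finset.sum_add_distrib, ← Finset.mul_sum, Finset.sum_sub_distrib]
    rw [e1, e2, norm_add_sq_real, norm_smul, mul_pow, Real.norm_eq_abs, sq_abs,
      real_inner_smul_right, hD]
    ring
  have hloc : IsLocalMin (fun t : ℝ => t * D + t ^ 2 * ‖y - x‖ ^ 2) 0 := by
    have hev : ∀ᶠ t : ℝ in nhds 0, ∀ i, 0 < β i + t * (c i - β i) := by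
      rw [eventually_all]
      intro i
      have : Tendsto (fun t : ℝ => β i + t * (c i - β i)) (nhds 0)
          (nhds (β i + 0 * (c i - β i))) := (by fun_prop : Continuous _).tendsto _
      exact this.eventually (lt_mem_nhds (by simpa using hβ i))
    filter_upwards [hev] with t ht
    have h := hmin (fun i => β i + t * (c i - β i)) ⟨fun i => (ht i).le, by
      rw [Finset.sum_add_distrib, ← Finset.mul_sum, Finset.sum_sub_distrib, hc1, hβ1]; ring⟩
    rw [hf] at h
    simp only [zero_mul, ne_eq, OfNat.ofNat_ne_zero, not_false_eq_true, zero_pow, add_zero]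
    linarith
  have hder : HasDerivAt (fun t : ℝ => t * D + t ^ 2 * ‖y - x‖ ^ 2) D 0 := by
    have := ((hasDerivAt_id' (0 : ℝ)).mul_const D).fun_add
      (((hasDerivAt_id' (0 : ℝ)).fun_pow 2).mul_const (‖y - x‖ ^ 2))
    exact this.congr_deriv (by simp)
  have hD0 := hloc.hasDerivAt_eq_zero hder
  have h1 := hf 1
  simp only [one_mul, add_sub_cancel, hD0] at h1
  rw [h1]
  ring

theorem exists_boundary_norm_sq_add_le [DecidableEq ι] (hcard : 2 ≤ Fintype.card ι) (a : ι → E)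
    (l : ι → ℝ) {α : ι → ℝ} (hα : α ∈ stdSimplex ℝ ι) :
    ∃ c ∈ stdSimplex ℝ ι, (∃ i, c i = 0) ∧
      ‖∑ i, c i • a i‖ ^ 2 + ∑ i, c i * l i ≤
        ‖∑ i, α i • a i‖ ^ 2 + ∑ i, α i * l i +
          (∑ i, α i * ‖a i‖ ^ 2 - ‖∑ i, α i • a i‖ ^ 2) / ((Fintype.card ι : ℝ) - 1) ^ 2 := by
  have hV := sum_mul_norm_sub_sq (a := a) hα.2 (∑ i, α i • a i)
  rw [sub_self, norm_zero, zero_pow two_ne_zero, add_zero] at hV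
  have hcont : Continuous fun c : ι → ℝ => ‖∑ i, c i • a i‖ ^ 2 + ∑ i, c i * l i := by fun_prop
  obtain ⟨β, hβ, hmin⟩ := (isCompact_stdSimplex ℝ ι).exists_isMinOn ⟨α, hα⟩ hcont.continuousOn
  rw [isMinOn_iff] at hmin
  by_cases hb : ∃ i, β i = 0
  · refine ⟨β, hβ, hb, (hmin α hα).trans (le_add_of_nonneg_right ?_)⟩
    rw [← hV]
    exact div_nonneg (Finset.sum_nonneg fun i _ => mul_nonneg (hα.1 i) (sq_nonneg _))
      (sq_nonneg _)
  push Not at hb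
  have hβ0 : ∀ i, 0 < β i := fun i => lt_of_le_of_ne (hβ.1 i) (hb i).symm
  have hcl : IsClosed {c : ι → ℝ | ∃ i, c i = 0} := by
    rw [Set.ofPred_exists]
    exact isClosed_iUnion_of_finite fun i => isClosed_eq (continuous_apply i) continuous_const
  have hne : (stdSimplex ℝ ι ∩ {c : ι → ℝ | ∃ i, c i = 0}).Nonempty := by
    have : Nontrivial ι := Fintype.one_lt_card_iff_nontrivial.1 hcard
    obtain ⟨i, j, hij⟩ := exists_pair_ne ι
    exact ⟨Pi.single i 1, single_mem_stdSimplex ℝ i, j, Pi.single_eq_of_ne hij.symm 1⟩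
  obtain ⟨c, ⟨hc, hci⟩, hcmin⟩ := ((isCompact_stdSimplex ℝ ι).inter_right hcl).exists_isMinOn hne
    hcont.continuousOn
  rw [isMinOn_iff] at hcmin
  refine ⟨c, hc, hci, ?_⟩
  have hid := fun {c : ι → ℝ} (hc : c ∈ stdSimplex ℝ ι) =>
    norm_sq_add_eq_of_isMinOn_of_pos hβ0 hβ.2 hmin hc.2
  set b := ∑ i, β i • a i with hbdef
  have hshift : ∀ c ∈ stdSimplex ℝ ι, ∑ i, c i • (a i - b) = (∑ i, c i • a i) - b := by
    intro c hc
    simp_rw [smul_sub]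
    rw [Finset.sum_sub_distrib, ← Finset.sum_smul, hc.2, one_smul]
  have hcore := sq_mul_sub_le_sum_of_boundary_le (a := fun i => a i - b) hβ0 hβ.2
    (by rw [hshift β hβ, hbdef, sub_self])
    (H := ‖(∑ i, c i • a i) - b‖ ^ 2)
    (fun c' hc' hi' => by
      have h1 := hcmin c' ⟨hc', hi'⟩
      rw [hid hc, hid hc'] at h1
      rw [hshift c' hc']
      linarith) hα
  rw [hshift α hα] at hcore
  simp only [sub_sub_sub_cancel_right] at hcore
  rw [hV, mul_comm, ← le_div_iff₀] at hcore
  · rw [hid hc, hid hα]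
    linarith
  · have : (2 : ℝ) ≤ Fintype.card ι := by exact_mod_cast hcard
    have : 0 < (Fintype.card ι : ℝ) - 1 := by linarith
    positivity


theorem exists_sparse_norm_sq_add_le {r n : ℕ} (hr : 1 ≤ r) (hrn : r ≤ n) (a : Fin n → E)
    (l : Fin n → ℝ) {α : Fin n → ℝ} (hα : α ∈ stdSimplex ℝ (Fin n)) :
    ∃ c ∈ stdSimplex ℝ (Fin n), ∃ J : Finset (Fin n), J.card = r ∧ (∀ i ∉ J, c i = 0) ∧
      ‖∑ i, c i • a i‖ ^ 2 + ∑ i, c i * l i ≤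
        ‖∑ i, α i • a i‖ ^ 2 + ∑ i, α i * l i +
          ((n : ℝ) - r) / (r * ((n : ℝ) - 1)) *
            (∑ i, α i * ‖a i‖ ^ 2 - ‖∑ i, α i • a i‖ ^ 2) := by
  induction n, hrn using Nat.le_induction with
  | base => exact ⟨α, hα, Finset.univ, by simp, by simp, by simp⟩
  | succ n hrn ih =>
    have hr0 : (1 : ℝ) ≤ r := by exact_mod_cast hr
    have hrn0 : (r : ℝ) ≤ n := by exact_mod_cast hrn
    set k : ℝ := ((n : ℝ) - r) / (r * ((n : ℝ) - 1)) with hk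
    have hk1 : k ≤ 1 := div_le_one_of_le₀ (by nlinarith) (by nlinarith)
    have hm : 0 ≤ 1 - k := by linarith
    have hrec : k + (1 - k) / (n : ℝ) ^ 2 = ((n + 1 : ℝ) - r) / (r * ((n + 1 : ℝ) - 1)) := by
      rcases eq_or_ne (n : ℝ) 1 with hn | hn
      · have : (r : ℝ) = 1 := by linarith
        simp [hk, hn, this]
      · have : (n : ℝ) - 1 ≠ 0 := sub_ne_zero.2 hn
        have : (n : ℝ) ≠ 0 := by linarith
        rw [hk, add_sub_cancel_right]
        field_simp
        ring
    have hs : √(1 - k) ^ 2 = 1 - k := Real.sq_sqrt hm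
    have hnorm : ∀ c : Fin (n + 1) → ℝ, ‖∑ i, c i • √(1 - k) • a i‖ ^ 2
        = (1 - k) * ‖∑ i, c i • a i‖ ^ 2 := by
      intro c
      simp_rw [smul_comm _ √(1 - k)]
      rw [← Finset.smul_sum, norm_smul, mul_pow, Real.norm_eq_abs, sq_abs, hs]
    have hlin : ∀ c : Fin (n + 1) → ℝ, ∑ i, c i * (l i + k * ‖a i‖ ^ 2)
        = ∑ i, c i * l i + k * ∑ i, c i * ‖a i‖ ^ 2 := by
      intro c
      rw [Finset.mul_sum, ← Finset.sum_add_distrib]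
      exact Finset.sum_congr rfl fun i _ => by ring
    have hmom : ∑ i, α i * ‖√(1 - k) • a i‖ ^ 2 = (1 - k) * ∑ i, α i * ‖a i‖ ^ 2 := by
      rw [Finset.mul_sum]
      refine Finset.sum_congr rfl fun i _ => ?_
      rw [norm_smul, mul_pow, Real.norm_eq_abs, sq_abs, hs]
      ring
    obtain ⟨c, hc, ⟨i₀, hi₀⟩, hle⟩ := exists_boundary_norm_sq_add_le
      (by rw [Fintype.card_fin]; omega) (fun i => √(1 - k) • a i)
      (fun i => l i + k * ‖a i‖ ^ 2) hα
    simp only [hnorm, hlin, hmom, Fintype.card_fin, Nat.cast_add, Nat.cast_one,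
      add_sub_cancel_right] at hle
    have hc' : (fun j => c (i₀.succAbove j)) ∈ stdSimplex ℝ (Fin n) := by
      refine ⟨fun j => hc.1 _, ?_⟩
      have := hc.2
      rwa [Fin.sum_univ_succAbove _ i₀, hi₀, zero_add] at this
    obtain ⟨c', hc'mem, J, hJ, hJ0, hle'⟩ := ih (fun j => a (i₀.succAbove j))
      (fun j => l (i₀.succAbove j)) hc'
    refine ⟨i₀.insertNth 0 c', ⟨?_, ?_⟩, J.map i₀.succAboveEmb, by simpa using hJ, ?_, ?_⟩
    · intro i
      cases i using i₀.succAboveCases with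
      | x => simp
      | p j => simpa using hc'mem.1 j
    · rw [Fin.sum_univ_succAbove _ i₀]
      simpa using hc'mem.2
    · intro i hi
      cases i using i₀.succAboveCases with
      | x => simp
      | p j => simpa using hJ0 j (by simpa using hi)
    · rw [Fin.sum_univ_succAbove _ i₀, Fin.sum_univ_succAbove _ i₀]
      rw [Fin.sum_univ_succAbove _ i₀, Fin.sum_univ_succAbove _ i₀,
        Fin.sum_univ_succAbove (fun i => c i * ‖a i‖ ^ 2) i₀] at hle
      simp only [Fin.insertNth_apply_same, Fin.insertNth_apply_succAbove, zero_smul, zero_mul,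
        zero_add, hi₀] at hle ⊢
      rw [Nat.cast_add, Nat.cast_one, ← hrec]
      have e : ((1 - k) * ∑ i, α i * ‖a i‖ ^ 2 - (1 - k) * ‖∑ i, α i • a i‖ ^ 2) / (n : ℝ) ^ 2
          = (1 - k) / (n : ℝ) ^ 2 * (∑ i, α i * ‖a i‖ ^ 2 - ‖∑ i, α i • a i‖ ^ 2) := by ring
      rw [e] at hle
      linarith

end Caratheodory

section Helly

variable {E ι : Type*} [NormedAddCommGroup E]

theorem exists_forall_norm_infDist_le [ProperSpace E] [Fintype ι] [Nonempty ι] (P : ι → Set E)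
    (hP : ∀ i, Bornology.IsBounded (P i)) (hne : ∀ i, (P i).Nonempty) :
    ∃ q, ∀ x, ‖fun i => infDist q (P i)‖ ≤ ‖fun i => infDist x (P i)‖ := by
  refine Continuous.exists_forall_le ?_ ?_
  · exact continuous_norm.comp (continuous_pi fun i => continuous_infDist_pt _)
  · obtain ⟨i⟩ := ‹Nonempty ι›
    obtain ⟨R, hR⟩ := (hP i).exists_norm_le
    refine tendsto_atTop_mono (fun x => ?_)
      (tendsto_atTop_add_const_right _ (-R) (tendsto_norm_cocompact_atTop (E := E)))
    have h1 : ‖x‖ - R ≤ infDist x (P i) := by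
      refine (le_infDist (hne i)).2 fun y hy => ?_
      have h2 := norm_sub_norm_le x y
      rw [dist_eq_norm]
      linarith [hR y hy]
    have h3 := norm_le_pi_norm (fun i => infDist x (P i)) i
    rw [Real.norm_eq_abs] at h3
    linarith [le_abs_self (infDist x (P i))]

variable [InnerProductSpace ℝ E]

theorem Convex.norm_sub_sq_le_inner_of_infDist_eq {K : Set E} (hK : Convex ℝ K) {q z : E}
    (hz : z ∈ K) (hd : infDist q K = dist q z) {p : E} (hp : p ∈ K) :
    ‖z - q‖ ^ 2 ≤ inner ℝ (p - q) (z - q) := by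
  have h := (norm_eq_iInf_iff_real_inner_le_zero hK hz (u := q)).1 (by
    rw [← dist_eq_norm, ← hd, infDist_eq_iInf]
    simp_rw [dist_eq_norm]) p hp
  have e1 : p - q = (p - z) + (z - q) := by abel
  have e2 : q - z = -(z - q) := by abel
  rw [e2, inner_neg_left, real_inner_comm] at h
  rw [e1, inner_add_left, real_inner_self_eq_norm_sq]
  linarith

theorem exists_balanced_nearest_points [ProperSpace E] [Fintype ι] [Nonempty ι] (P : ι → Set E)
    (hP : ∀ i, IsCompact (P i)) (hne : ∀ i, (P i).Nonempty) :
    ∃ (q : E) (z : ι → E) (α : ι → ℝ), (∀ i, z i ∈ P i) ∧ (∀ i, infDist q (P i) = dist q (z i)) ∧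
      α ∈ stdSimplex ℝ ι ∧ ∑ i, α i • (z i - q) = 0 ∧
      ∀ i, ‖z i - q‖ ^ 2 ≤ ∑ j, α j * ‖z j - q‖ ^ 2 := by
  classical
  obtain ⟨q, hq⟩ := exists_forall_norm_infDist_le P (fun i => (hP i).isBounded) hne
  choose z hz hd using fun i => (hP i).exists_infDist_eq_dist (hne i) q
  have hna : ∀ i, ‖z i - q‖ = infDist q (P i) := fun i => by
    rw [hd, dist_comm, dist_eq_norm]
  obtain ⟨ρ, hρ⟩ : ∃ ρ, ρ = ‖fun i => infDist q (P i)‖ := ⟨_, rfl⟩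
  have hle : ∀ i, ‖z i - q‖ ≤ ρ := fun i => by
    have := norm_le_pi_norm (fun i => infDist q (P i)) i
    rwa [Real.norm_of_nonneg infDist_nonneg, ← hρ, ← hna] at this
  have hex : ∃ i, ‖z i - q‖ = ρ := by
    obtain ⟨i, hi⟩ := Finite.exists_max fun i => infDist q (P i)
    refine ⟨i, le_antisymm (hle i) ?_⟩
    rw [hρ, pi_norm_le_iff_of_nonneg (norm_nonneg _)]
    intro j
    rw [Real.norm_of_nonneg infDist_nonneg, hna]
    exact hi j
  set T : Set (ι → ℝ) := {α | ∀ i, ‖z i - q‖ ≠ ρ → α i = 0} with hT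
  have hTconv : Convex ℝ T := by
    intro x hx y hy s t _ _ _ i hi
    simp [hx i hi, hy i hi]
  have hTcl : IsClosed T := by
    rw [hT]
    simp_rw [Set.ofPred_forall]
    exact isClosed_iInter fun i => isClosed_iInter fun _ =>
      isClosed_eq (continuous_apply i) continuous_const
  set φ := Fintype.linearCombination ℝ fun i => z i - q with hφ
  set K : Set E := φ '' (stdSimplex ℝ ι ∩ T) with hK
  have hKconv : Convex ℝ K := ((convex_stdSimplex ℝ ι).inter hTconv).linear_image φ
  have hKcomp : IsCompact K := ((isCompact_stdSimplex ℝ ι).inter_right hTcl).image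
    (by simp only [hφ]; fun_prop)
  have hKmem : ∀ i, ‖z i - q‖ = ρ → z i - q ∈ K := fun i hi =>
    ⟨Pi.single i 1, ⟨single_mem_stdSimplex ℝ i, fun j hj =>
      Pi.single_eq_of_ne (fun h : j = i => hj (by rw [h]; exact hi)) 1⟩, by simp [hφ]⟩
  have h0 : (0 : E) ∈ K := by
    obtain ⟨i, hi⟩ := hex
    obtain ⟨u, hu, hmin⟩ := exists_norm_eq_iInf_of_complete_convex ⟨_, hKmem i hi⟩
      hKcomp.isComplete hKconv 0
    rw [norm_eq_iInf_iff_real_inner_le_zero hKconv hu] at hmin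
    by_contra hcon
    have hu0 : u ≠ 0 := fun h => hcon (h ▸ hu)
    have hupos : 0 < ‖u‖ ^ 2 := by positivity
    have hev : ∀ᶠ ε : ℝ in nhdsWithin 0 (Set.Ioi 0), ∀ i, ‖z i - (q + ε • u)‖ < ρ := by
      rw [eventually_all]
      intro i
      by_cases hi : ‖z i - q‖ = ρ
      · have hin := hmin _ (hKmem i hi)
        rw [zero_sub, inner_neg_left, inner_sub_right, real_inner_self_eq_norm_sq] at hin
        filter_upwards [Ioo_mem_nhdsGT (zero_lt_one (α := ℝ))] with ε hε
        refine lt_of_pow_lt_pow_left₀ 2 ((norm_nonneg _).trans (hle i)) ?_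
        rw [← sub_sub, norm_sub_sq_real, hi, norm_smul, mul_pow, real_inner_smul_right,
          real_inner_comm, Real.norm_eq_abs, sq_abs]
        have h1 := mul_pos hε.1 hupos
        have h2 := mul_lt_mul_of_pos_right hε.2 h1
        have h3 : 0 ≤ ε * (inner ℝ u (z i - q) - ‖u‖ ^ 2) := mul_nonneg hε.1.le (by linarith)
        nlinarith
      · have hlt := lt_of_le_of_ne (hle i) hi
        have hc : Tendsto (fun ε : ℝ => ‖z i - (q + ε • u)‖) (nhds 0)
            (nhds ‖z i - (q + (0 : ℝ) • u)‖) := (by fun_prop : Continuous _).tendsto _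
        exact (hc.eventually (gt_mem_nhds (by simpa using hlt))).filter_mono nhdsWithin_le_nhds
    obtain ⟨ε, hε⟩ := hev.exists
    have hlt : ‖fun i => infDist (q + ε • u) (P i)‖ < ρ := by
      rw [pi_norm_lt_iff ((norm_nonneg _).trans_lt (hε i))]
      intro j
      rw [Real.norm_of_nonneg infDist_nonneg]
      refine (infDist_le_dist_of_mem (hz j)).trans_lt ?_
      rw [dist_comm, dist_eq_norm]
      exact hε j
    exact absurd (hq (q + ε • u)) (by rw [← hρ]; exact not_le.2 hlt)
  obtain ⟨α, ⟨hα, hαT⟩, hα0⟩ := h0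
  refine ⟨q, z, α, hz, hd, hα, by simpa [hφ, Fintype.linearCombination_apply] using hα0, ?_⟩
  intro i
  have : ∑ j, α j * ‖z j - q‖ ^ 2 = ∑ j, α j * ρ ^ 2 := by
    refine Finset.sum_congr rfl fun j _ => ?_
    by_cases hj : ‖z j - q‖ = ρ
    · rw [hj]
    · rw [hαT j hj, zero_mul, zero_mul]
  rw [this, ← Finset.sum_mul, hα.2, one_mul]
  exact pow_le_pow_left₀ (norm_nonneg _) (hle i) 2

end Helly

/-- **Dimension independent Helly theorem** (Adiprasito–Bárány–Mustafa–Terpai).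
If the closed unit ball around `b` meets the intersection of every `r` of the
convex sets `C₁, …, Cₙ`, then some point `q` is within distance
`√((n - r) / (r (n - 1)))` of every `Cᵢ`. -/
theorem dimension_independent_helly {d n : ℕ} (hn : 2 ≤ n) (r : ℕ)
    (hr1 : 1 ≤ r) (hrn : r ≤ n)
    (C : Fin n → Set (EuclideanSpace ℝ (Fin d))) (hC : ∀ i, Convex ℝ (C i))
    (b : EuclideanSpace ℝ (Fin d))
    (h : ∀ J : Finset (Fin n), J.card = r →
      (Metric.closedBall b 1 ∩ ⋂ j ∈ J, C j).Nonempty) :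
    ∃ q : EuclideanSpace ℝ (Fin d), ∀ i,
      Metric.infDist q (C i) ≤
        Real.sqrt (((n : ℝ) - (r : ℝ)) / ((r : ℝ) * ((n : ℝ) - 1))) := by
  have hr0 : (1 : ℝ) ≤ r := by exact_mod_cast hr1
  have hrn0 : (r : ℝ) ≤ n := by exact_mod_cast hrn
  have hn0 : (2 : ℝ) ≤ n := by exact_mod_cast hn
  set k : ℝ := ((n : ℝ) - r) / (r * ((n : ℝ) - 1)) with hk
  choose! y hy using h
  rcases eq_or_lt_of_le hrn with rfl | hlt
  · refine ⟨y Finset.univ, fun i => ?_⟩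
    have hmem := (hy Finset.univ (by simp)).2
    simp only [Finset.mem_univ, Set.iInter_true, Set.mem_iInter] at hmem
    rw [infDist_zero_of_mem (hmem i)]
    exact Real.sqrt_nonneg _
  have hk0 : 0 < k := by
    have : (r : ℝ) < n := by exact_mod_cast hlt
    exact div_pos (by linarith) (mul_pos (by linarith) (by linarith))
  have : Nonempty (Fin n) := ⟨⟨0, by omega⟩⟩
  set P : Fin n → Set (EuclideanSpace ℝ (Fin d)) := fun i =>
    convexHull ℝ (y '' {J | J.card = r ∧ i ∈ J}) with hP
  have hPC : ∀ i, P i ⊆ C i := fun i => by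
    refine convexHull_min ?_ (hC i)
    rintro _ ⟨J, ⟨hJ, hiJ⟩, rfl⟩
    exact Set.mem_iInter₂.1 (hy J hJ).2 i hiJ
  have hPne : ∀ i, (P i).Nonempty := fun i => by
    obtain ⟨J, hiJ, -, hJ⟩ := Finset.exists_subsuperset_card_eq (Finset.subset_univ {i})
      (by simpa using hr1) (by simpa using hrn)
    exact ⟨_, subset_convexHull ℝ _ ⟨J, ⟨hJ, hiJ (by simp)⟩, rfl⟩⟩
  obtain ⟨q, z, α, hz, hd, hα, hα0, hρ⟩ := exists_balanced_nearest_points P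
    (fun i => ((Set.toFinite _).image y).isCompact_convexHull ℝ) hPne
  refine ⟨q, fun i => (infDist_le_infDist_of_subset (hPC i) (hPne i)).trans ?_⟩
  rw [hd, dist_comm, dist_eq_norm]
  refine Real.le_sqrt_of_sq_le ((hρ i).trans ?_)
  set s := ∑ j, α j * ‖z j - q‖ ^ 2 with hs
  by_contra! hks
  have hs0 : 0 < s := hk0.trans hks
  -- The scale `t = √(k * s)` linearises the norm of the sparse combination below.
  set t := √(k * s) with ht
  have ht0 : 0 < t := Real.sqrt_pos.2 (mul_pos hk0 hs0)
  have ht2 : t ^ 2 = k * s := Real.sq_sqrt (mul_pos hk0 hs0).le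
  have hts : t < s := lt_of_pow_lt_pow_left₀ 2 hs0.le (by rw [ht2]; nlinarith)
  have hsum : ∀ c : Fin n → ℝ,
      ∑ j, c j * (2 * t * (inner ℝ (b - q) (z j - q) - ‖z j - q‖ ^ 2))
      = 2 * t * (inner ℝ (b - q) (∑ j, c j • (z j - q)) - ∑ j, c j * ‖z j - q‖ ^ 2) := by
    intro c
    rw [inner_sum, ← Finset.sum_sub_distrib, Finset.mul_sum]
    refine Finset.sum_congr rfl fun j _ => ?_
    rw [real_inner_smul_right]
    ring
  obtain ⟨c, hc, J, hJ, hcJ, hle⟩ := exists_sparse_norm_sq_add_le hr1 hrn (fun j => z j - q)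
    (fun j => 2 * t * (inner ℝ (b - q) (z j - q) - ‖z j - q‖ ^ 2)) hα
  rw [hsum, hsum, hα0, norm_zero, inner_zero_right, ← hs, ← hk] at hle
  set A := ∑ j, c j • (z j - q) with hA
  have hsupp : ∑ j, c j * ‖z j - q‖ ^ 2 ≤ inner ℝ (y J - q) A := by
    rw [hA, inner_sum]
    refine Finset.sum_le_sum fun j _ => ?_
    rw [real_inner_smul_right]
    by_cases hj : j ∈ J
    · exact mul_le_mul_of_nonneg_left ((convex_convexHull ℝ _).norm_sub_sq_le_inner_of_infDist_eq
        (hz j) (hd j) (subset_convexHull ℝ _ ⟨J, ⟨hJ, hj⟩, rfl⟩)) (hc.1 j)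
    · rw [hcJ j hj, zero_mul, zero_mul]
  have hyb : inner ℝ (y J - b) A ≤ ‖A‖ := by
    have h1 : ‖y J - b‖ ≤ 1 := by
      rw [← dist_eq_norm]
      exact (hy J hJ).1
    exact (real_inner_le_norm _ _).trans (mul_le_of_le_one_left (norm_nonneg _) h1)
  have hsplit : inner ℝ (y J - q) A = inner ℝ (y J - b) A + inner ℝ (b - q) A := by
    rw [← inner_add_left, sub_add_sub_cancel]
  have hfin : 2 * t * (∑ j, c j * ‖z j - q‖ ^ 2) ≤ 2 * t * (‖A‖ + inner ℝ (b - q) A) :=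
    mul_le_mul_of_nonneg_left (by linarith) (by positivity)
  nlinarith [sq_nonneg (‖A‖ - t), mul_pos ht0 (sub_pos.2 hts)]
end

section
/- Let 𝓕₁, …, 𝓕ᵣ be families of convex sets in ℝ^d with r ≤ d, and let b ∈ ℝ^d. Assume that for every r-tuple (C₁, …, Cᵣ) with Cᵢ ∈ 𝓕ᵢ for all i ∈ {1, …, r}, the intersection C₁ ∩ ⋯ ∩ Cᵣ ∩ B(b,1) is nonempty. Then there exist a point q ∈ ℝ^d and an index i ∈ {1, …, r} such that every C ∈ 𝓕ᵢ satisfies d(q, C) ≤ 1/√r. -/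
open Metric Filter

/-- The nearest-point projection `q` of `b` onto a nonempty closed convex set `K` satisfies
the obtuse-angle inequality `‖q - b‖² + ‖p - q‖² ≤ ‖p - b‖²` for all `p ∈ K`. -/
lemma exists_mem_forall_norm_sub_sq_add_norm_sub_sq_le {E : Type*} [NormedAddCommGroup E]
    [InnerProductSpace ℝ E] [CompleteSpace E] {K : Set E} (hne : K.Nonempty) (hcl : IsClosed K)
    (hconv : Convex ℝ K) (b : E) :
    ∃ q ∈ K, ∀ p ∈ K, ‖q - b‖ ^ 2 + ‖p - q‖ ^ 2 ≤ ‖p - b‖ ^ 2 := by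
  obtain ⟨q, hq, hmin⟩ := exists_norm_eq_iInf_of_complete_convex hne hcl.isComplete hconv b
  refine ⟨q, hq, fun p hp => ?_⟩
  have hinner := (norm_eq_iInf_iff_real_inner_le_zero hconv hq).1 hmin p hp
  have hexp := norm_sub_sq_real (p - q) (b - q)
  rw [sub_sub_sub_cancel_right, real_inner_comm, norm_sub_rev b q] at hexp
  linarith

/-- If no point is within distance `c` of all members of any one family, one can pick a member of
each family so that every common point of the picks indexed by `s` is at squared distance at least
`#s * c ^ 2` from `b`, strictly if `s` is nonempty. -/
lemma exists_selection_card_mul_sq_lt_norm_sub_sq {E ι : Type*} [NormedAddCommGroup E]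
    [InnerProductSpace ℝ E] [CompleteSpace E] (𝓕 : ι → Set (Set E))
    (hconv : ∀ i, ∀ C ∈ 𝓕 i, Convex ℝ C)
    (hinter : ∀ C : ι → Set E, (∀ i, C i ∈ 𝓕 i) → (⋂ i, C i).Nonempty)
    {c : ℝ} (hc : 0 ≤ c) (hfar : ∀ q i, ∃ C ∈ 𝓕 i, c < Metric.infDist q C)
    (b : E) (s : Finset ι) :
    ∃ C : ι → Set E, (∀ i, C i ∈ 𝓕 i) ∧ ∃ q ∈ ⋂ i ∈ s, closure (C i),
      (s.card * c ^ 2 ≤ ‖q - b‖ ^ 2 ∧ (s.Nonempty → s.card * c ^ 2 < ‖q - b‖ ^ 2)) ∧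
      ∀ p ∈ ⋂ i ∈ s, closure (C i), ‖q - b‖ ^ 2 + ‖p - q‖ ^ 2 ≤ ‖p - b‖ ^ 2 := by
  classical
  induction s using Finset.induction_on with
  | empty =>
    choose C hC _ using hfar b
    exact ⟨C, hC, b, by simp, by simp, by simp⟩
  | insert a s ha ih =>
    obtain ⟨C, hC, q, -, ⟨hcard, -⟩, hq⟩ := ih
    obtain ⟨D, hD, hqD⟩ := hfar q a
    have hC' : ∀ i, Function.update C a D i ∈ 𝓕 i := by
      intro i
      rcases eq_or_ne i a with rfl | hi
      · simpa using hD
      · simpa [hi] using hC i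
    refine ⟨Function.update C a D, hC', ?_⟩
    set C' := Function.update C a D with hC'def
    obtain ⟨x, hx⟩ := hinter C' hC'
    obtain ⟨q', hq', hmin⟩ := exists_mem_forall_norm_sub_sq_add_norm_sub_sq_le
      (K := ⋂ i ∈ insert a s, closure (C' i))
      ⟨x, Set.mem_iInter₂.2 fun i _ => subset_closure (Set.mem_iInter.1 hx i)⟩
      (isClosed_biInter fun _ _ => isClosed_closure)
      (convex_iInter₂ fun i _ => (hconv i _ (hC' i)).closure) b
    have hq'D : q' ∈ closure D := by
      simpa [hC'def] using Set.mem_iInter₂.1 hq' a (Finset.mem_insert_self a s)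
    have hq'C : q' ∈ ⋂ i ∈ s, closure (C i) := Set.mem_iInter₂.2 fun i hi => by
      simpa [hC'def, ne_of_mem_of_not_mem hi ha]
        using Set.mem_iInter₂.1 hq' i (Finset.mem_insert_of_mem hi)
    have hdist : c < ‖q' - q‖ := by
      rw [← dist_eq_norm, dist_comm]
      rw [← Metric.infDist_closure] at hqD
      exact hqD.trans_le (Metric.infDist_le_dist_of_mem hq'D)
    have hlt : (insert a s).card * c ^ 2 < ‖q' - b‖ ^ 2 := by
      have hsq := pow_lt_pow_left₀ hdist hc two_ne_zero
      rw [Finset.card_insert_of_notMem ha]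
      push_cast
      linarith [hq q' hq'C]
    exact ⟨q', hq', ⟨hlt.le, fun _ => hlt⟩, hmin⟩

/-- **Colorful dimension independent Helly theorem**
(Adiprasito–Bárány–Mustafa–Terpai). If every colorful `r`-tuple from the
families `𝓕₁, …, 𝓕ᵣ` of convex sets meets the closed unit ball around `b`,
then for some index `i` there is a point `q` within distance `1/√r`
of every member of `𝓕ᵢ`. -/
theorem colorful_dimension_independent_helly {d r : ℕ} (hr : 1 ≤ r) (hrd : r ≤ d)
    (𝓕 : Fin r → Set (Set (EuclideanSpace ℝ (Fin d))))
    (hconv : ∀ i, ∀ C ∈ 𝓕 i, Convex ℝ C)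
    (b : EuclideanSpace ℝ (Fin d))
    (h : ∀ C : Fin r → Set (EuclideanSpace ℝ (Fin d)), (∀ i, C i ∈ 𝓕 i) →
      ((⋂ i, C i) ∩ Metric.closedBall b 1).Nonempty) :
    ∃ (q : EuclideanSpace ℝ (Fin d)) (i : Fin r),
      ∀ C ∈ 𝓕 i, Metric.infDist q C ≤ 1 / Real.sqrt r := by
  by_contra! hfar
  obtain ⟨C, hC, q, -, ⟨-, hlt⟩, hq⟩ := exists_selection_card_mul_sq_lt_norm_sub_sq 𝓕 hconv
    (fun C hC => (h C hC).mono Set.inter_subset_left) (by positivity) hfar b Finset.univ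
  obtain ⟨p, hp, hpb⟩ := h C hC
  have hqp := hq p (Set.mem_iInter₂.2 fun i _ => subset_closure (Set.mem_iInter.1 hp i))
  have hqb := hlt ⟨⟨0, hr⟩, Finset.mem_univ _⟩
  have hr' : (r : ℝ) ≠ 0 := by positivity
  rw [Finset.card_univ, Fintype.card_fin, div_pow, Real.sq_sqrt r.cast_nonneg, one_pow,
    mul_one_div_cancel hr'] at hqb
  rw [Metric.mem_closedBall, dist_eq_norm] at hpb
  nlinarith [norm_nonneg (p - b), sq_nonneg ‖p - q‖]
end

section
/- Let d ≥ 1 and 1 ≤ k ≤ d − 1. Suppose for each i ∈ {1, …, d+1}, 𝓢ᵢ is a k-unbounded family of compact convex sets in ℝ^d, and there exists R > 0 such that diam(C) < R for every C ∈ 𝓢₁ ∪ ⋯ ∪ 𝓢_{d+1}. Assume that for every (d+1)-tuple (C₁, …, C_{d+1}) ∈ 𝓢₁ × ⋯ × 𝓢_{d+1} there exists a k-flat H intersecting Cᵢ for all i ∈ {1, …, d+1}. Then there exist j ∈ {1, …, d+1} and a k-flat H̃ that intersects every set in 𝓢ⱼ. -/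
open Metric Filter

/-- Distance between two sets: `inf {‖p₁ - p₂‖ : p₁ ∈ S₁, p₂ ∈ S₂}`. -/
noncomputable def setDist {d : ℕ} (S₁ S₂ : Set (EuclideanSpace ℝ (Fin d))) : ℝ :=
  sInf {r : ℝ | ∃ p₁ ∈ S₁, ∃ p₂ ∈ S₂, r = ‖p₁ - p₂‖}

/-- `y` is a limiting direction of the family `𝓕`: there are pairwise distinct sets
`Sₙ ∈ 𝓕` and points `sₙ ∈ Sₙ` with `‖sₙ‖ → ∞` and `sₙ / ‖sₙ‖ → y`. -/
def IsLimitingDirection {d : ℕ} (𝓕 : Set (Set (EuclideanSpace ℝ (Fin d))))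
    (y : EuclideanSpace ℝ (Fin d)) : Prop :=
  ‖y‖ = 1 ∧
  ∃ (S : ℕ → Set (EuclideanSpace ℝ (Fin d))) (s : ℕ → EuclideanSpace ℝ (Fin d)),
    (∀ n, S n ∈ 𝓕) ∧ (∀ m n, m ≠ n → S m ≠ S n) ∧ (∀ n, s n ∈ S n) ∧
    Tendsto (fun n => ‖s n‖) atTop atTop ∧
    Tendsto (fun n => (‖s n‖)⁻¹ • s n) atTop (nhds y)

/-- The set of limiting directions of a family. -/
def LDS {d : ℕ} (𝓕 : Set (Set (EuclideanSpace ℝ (Fin d)))) :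
    Set (EuclideanSpace ℝ (Fin d)) :=
  {y | IsLimitingDirection 𝓕 y}

/-- A family is `k`-unbounded if the linear span of its limiting directions has
dimension at least `k`. -/
def KUnbounded {d : ℕ} (k : ℕ) (𝓕 : Set (Set (EuclideanSpace ℝ (Fin d)))) : Prop :=
  k ≤ Module.finrank ℝ (Submodule.span ℝ (LDS 𝓕))

/-- A `k`-flat: a nonempty affine subspace whose direction has dimension `k`. -/
def IsKFlat {d : ℕ} (k : ℕ) (K : AffineSubspace ℝ (EuclideanSpace ℝ (Fin d))) : Prop :=
  (K : Set (EuclideanSpace ℝ (Fin d))).Nonempty ∧ Module.finrank ℝ K.direction = k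

/-- The set of points common to all `c i` with `i ≠ j`. -/
def interExcept {ι F : Type*} (c : ι → Set F) (j : ι) : Set F :=
  ⋂ i, ⋂ (_ : i ≠ j), c i

section ColorfulHelly

variable {ι F : Type*} [Fintype ι] [NormedAddCommGroup F] [NormedSpace ℝ F]
  [FiniteDimensional ℝ F]

/-- For `dim F + 1` convex sets with a common point, the distance from the origin to the
intersection is attained by the intersection of all but one of the sets. -/
theorem exists_le_infDist_interExcept (hι : Fintype.card ι = Module.finrank ℝ F + 1)
    {c : ι → Set F} (hconv : ∀ i, Convex ℝ (c i)) {u : F} (hu : ∀ i, u ∈ c i)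
    (hmin : ∀ x, (∀ i, x ∈ c i) → ‖u‖ ≤ ‖x‖) :
    ∃ j, ‖u‖ ≤ infDist 0 (interExcept c j) := by
  classical
  by_contra! hlt
  let G : Option ι → Set F := fun o => o.elim (ball 0 ‖u‖) c
  have hG : (⋂ o ∈ (Finset.univ : Finset (Option ι)), G o).Nonempty := by
    refine Convex.helly_theorem' (𝕜 := ℝ) ?_ ?_
    · rintro (_ | i) -
      · exact convex_ball _ _
      · exact hconv i
    · intro J _ hJ
      obtain ⟨o, ho⟩ : ∃ o, o ∉ J := by
        by_contra! hall
        rw [Finset.eq_univ_iff_forall.2 hall, Finset.card_univ, Fintype.card_option, hι] at hJ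
        omega
      rcases o with _ | j
      · refine ⟨u, Set.mem_iInter₂.2 ?_⟩
        rintro (_ | i) hi
        · exact absurd hi ho
        · exact hu i
      · have hne : (interExcept c j).Nonempty :=
          ⟨u, Set.mem_iInter₂.2 fun i _ => hu i⟩
        obtain ⟨x, hx, hxu⟩ := (infDist_lt_iff hne).1 (hlt j)
        refine ⟨x, Set.mem_iInter₂.2 ?_⟩
        rintro (_ | i) hi
        · rwa [dist_comm] at hxu
        · exact Set.mem_iInter₂.1 hx i fun h => ho (h ▸ hi)
  obtain ⟨x, hx⟩ := hG
  have hx' : ∀ o, x ∈ G o := fun o => Set.mem_iInter₂.1 hx o (Finset.mem_univ o)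
  have hball : ‖x‖ < ‖u‖ := by simpa [G] using hx' none
  exact hball.not_ge (hmin x fun i => hx' (some i))

variable [StrictConvexSpace ℝ F]

/-- The **colorful Helly theorem** for finite nonempty families. -/
theorem colorful_helly_of_finite (hι : Fintype.card ι = Module.finrank ℝ F + 1)
    {T : ι → Set (Set F)} (hfin : ∀ i, (T i).Finite) (hne : ∀ i, (T i).Nonempty)
    (hT : ∀ i, ∀ K ∈ T i, IsCompact K ∧ Convex ℝ K)
    (h : ∀ c : ι → Set F, (∀ i, c i ∈ T i) → (⋂ i, c i).Nonempty) :
    ∃ j x, ∀ K ∈ T j, x ∈ K := by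
  classical
  have : Nonempty ι := Fintype.card_pos_iff.1 (by omega)
  have hclosed : ∀ c : ι → Set F, (∀ i, c i ∈ T i) → ∀ i, IsClosed (c i) :=
    fun c hc i => (hT i _ (hc i)).1.isClosed
  obtain ⟨⟨j, c⟩, hc, hmax⟩ :=
    Set.exists_max_image ((Set.univ : Set ι) ×ˢ Set.univ.pi T)
      (fun p => infDist 0 (interExcept p.2 p.1))
      (Set.finite_univ.prod (Set.Finite.pi' hfin |>.subset fun _ hx i => hx i trivial))
      (Set.univ_nonempty.prod (Set.univ_pi_nonempty_iff.2 hne))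
  replace hc : ∀ i, c i ∈ T i := fun i => hc.2 i trivial
  have hDclosed : IsClosed (interExcept c j) :=
    isClosed_iInter fun i => isClosed_iInter fun _ => hclosed c hc i
  have hDconv : Convex ℝ (interExcept c j) :=
    convex_iInter₂ fun i _ => (hT i _ (hc i)).2
  have hDne : (interExcept c j).Nonempty :=
    (h c hc).mono fun x hx => Set.mem_iInter₂.2 fun i _ => Set.mem_iInter.1 hx i
  obtain ⟨v, hv, hvdist⟩ := hDclosed.exists_infDist_eq_dist hDne 0
  refine ⟨j, v, fun K hK => ?_⟩
  have hc' : ∀ i, Function.update c j K i ∈ T i := by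
    intro i
    rcases eq_or_ne i j with rfl | hij
    · simpa using hK
    · simpa [hij] using hc i
  obtain ⟨u, hu, hudist⟩ :=
    (isClosed_iInter (hclosed _ hc')).exists_infDist_eq_dist (h _ hc') 0
  rw [Set.mem_iInter] at hu
  rw [dist_zero_left] at hvdist hudist
  obtain ⟨l, hl⟩ := exists_le_infDist_interExcept hι (fun i => (hT i _ (hc' i)).2) hu
    fun x hx => by
      rw [← hudist, ← dist_zero_left]
      exact infDist_le_dist_of_mem (Set.mem_iInter.2 hx)
  have huv : ‖u‖ ≤ ‖v‖ :=
    hvdist ▸ hl.trans (hmax (l, Function.update c j K) ⟨trivial, fun i _ => hc' i⟩)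
  have huD : u ∈ interExcept c j :=
    Set.mem_iInter₂.2 fun i hi => by simpa [hi] using hu i
  have hvmin : ∀ x ∈ interExcept c j, ‖v‖ ≤ ‖x‖ := fun x hx => by
    rw [← hvdist, ← dist_zero_left]
    exact infDist_le_dist_of_mem hx
  have hnorm : ‖v‖ = ‖u‖ := (hvmin u huD).antisymm huv
  have hvu : v = u := by
    by_contra hne
    refine ((norm_midpoint_lt_iff hnorm).2 hne).not_ge (hvmin _ ?_)
    rw [smul_add]
    exact hDconv hv huD (by norm_num) (by norm_num) (by norm_num)
  simpa [hvu] using hu j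

/-- The **colorful Helly theorem**: given `dim F + 1` families of compact convex sets such that
every colorful selection has a common point, some family has a common point. -/
theorem colorful_helly (hι : Fintype.card ι = Module.finrank ℝ F + 1)
    {T : ι → Set (Set F)} (hT : ∀ i, ∀ K ∈ T i, IsCompact K ∧ Convex ℝ K)
    (h : ∀ c : ι → Set F, (∀ i, c i ∈ T i) → (⋂ i, c i).Nonempty) :
    ∃ j x, ∀ K ∈ T j, x ∈ K := by
  classical
  by_contra! hempty
  have hsub : ∀ i, ∃ A ⊆ T i, A.Finite ∧ A.Nonempty ∧ ∀ x, ∃ K ∈ A, x ∉ K := by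
    intro i
    obtain ⟨K₀, hK₀, -⟩ := hempty i 0
    obtain ⟨s, hs⟩ := (hT i K₀ hK₀).1.elim_finite_subfamily_closed
      (fun K : T i => (K : Set F)) (fun K => (hT i K K.2).1.isClosed) (by
        refine Set.eq_empty_of_forall_notMem fun x hx => ?_
        obtain ⟨K, hK, hxK⟩ := hempty i x
        exact hxK (Set.mem_iInter.1 hx.2 ⟨K, hK⟩))
    refine ⟨insert K₀ (Subtype.val '' (s : Set (T i))), ?_,
      (s.finite_toSet.image _).insert _, Set.insert_nonempty _ _, fun x => ?_⟩
    · rintro K (rfl | ⟨K, -, rfl⟩)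
      exacts [hK₀, K.2]
    · by_contra! hx
      have : x ∈ K₀ ∩ ⋂ K ∈ s, (K : Set F) :=
        ⟨hx _ (Set.mem_insert _ _), Set.mem_iInter₂.2 fun K hK =>
          hx _ (Set.mem_insert_of_mem _ ⟨K, hK, rfl⟩)⟩
      rwa [hs] at this
  choose A hA hfin hne hAempty using hsub
  obtain ⟨j, x, hx⟩ := colorful_helly_of_finite hι hfin hne
    (fun i K hK => hT i K (hA i hK)) fun c hc => h c fun i => hA i (hc i)
  obtain ⟨K, hK, hxK⟩ := hAempty j x
  exact hxK (hx K hK)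

end ColorfulHelly

/-- Sets whose spans have dimension at least `k` admit a linearly independent system of `k`
representatives. -/
theorem exists_linearIndependent_mem_of_le_finrank_span {E : Type*} [AddCommGroup E]
    [Module ℝ E] [FiniteDimensional ℝ E] :
    ∀ {k : ℕ} (A : Fin k → Set E), (∀ i, k ≤ Module.finrank ℝ (Submodule.span ℝ (A i))) →
      ∃ y : Fin k → E, (∀ i, y i ∈ A i) ∧ LinearIndependent ℝ y
  | 0, _, _ => ⟨Fin.elim0, fun i => i.elim0, linearIndependent_empty_type⟩
  | k + 1, A, hA => by
    obtain ⟨y, hy, hli⟩ := exists_linearIndependent_mem_of_le_finrank_span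
      (fun i => A (Fin.castSucc i)) fun i => (Nat.le_succ k).trans (hA _)
    obtain ⟨z, hz, hzy⟩ : ∃ z ∈ A (Fin.last k), z ∉ Submodule.span ℝ (Set.range y) := by
      by_contra! hsub
      have h₁ := Submodule.finrank_mono (Submodule.span_le.2 hsub)
      have h₂ : Module.finrank ℝ (Submodule.span ℝ (Set.range y)) ≤ k := by
        simpa [Set.finrank] using finrank_range_le_card (R := ℝ) y
      have h₃ := hA (Fin.last k)
      omega
    refine ⟨Fin.snoc y z, fun i => ?_, linearIndependent_finSnoc.2 ⟨hli, hzy⟩⟩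
    induction i using Fin.lastCases with
    | last => simpa using hz
    | cast i => simpa using hy i

/-- If subspaces of dimension at most `k` contain vectors converging to `k` linearly independent
vectors, then limits of vectors of these subspaces lie in the span of the limit vectors. -/
theorem mem_span_range_of_tendsto {E : Type*} [NormedAddCommGroup E] [NormedSpace ℝ E]
    [FiniteDimensional ℝ E] {k : ℕ} {y : Fin k → E} (hy : LinearIndependent ℝ y)
    {W : ℕ → Submodule ℝ E} (hW : ∀ n, Module.finrank ℝ (W n) ≤ k)
    {v : ℕ → Fin k → E} (hvW : ∀ n j, v n j ∈ W n)
    (hv : ∀ j, Tendsto (fun n => v n j) atTop (nhds (y j)))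
    {w : ℕ → E} (hwW : ∀ n, w n ∈ W n) {w₀ : E} (hw : Tendsto w atTop (nhds w₀)) :
    w₀ ∈ Submodule.span ℝ (Set.range y) := by
  by_contra hnot
  have hli : LinearIndependent ℝ (Fin.cons w₀ y : Fin (k + 1) → E) :=
    linearIndependent_finCons.2 ⟨hy, hnot⟩
  have hlim : Tendsto (fun n => (Fin.cons (w n) (v n) : Fin (k + 1) → E)) atTop
      (nhds (Fin.cons w₀ y)) := by
    refine tendsto_pi_nhds.2 fun i => ?_
    induction i using Fin.cases with
    | zero => simpa using hw
    | succ i => simpa using hv i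
  obtain ⟨n, hn⟩ := (hlim.eventually
    (isOpen_setOfPred_linearIndependent.mem_nhds hli)).exists
  have hmem : ∀ i, (Fin.cons (w n) (v n) : Fin (k + 1) → E) i ∈ W n := by
    intro i
    induction i using Fin.cases with
    | zero => simpa using hwW n
    | succ i => simpa using hvW n i
  have hspan := Submodule.finrank_mono (Submodule.span_le.2 (Set.range_subset_iff.2 hmem))
  rw [finrank_span_eq_card hn, Fintype.card_fin] at hspan
  have := hW n
  omega

/-- Points at bounded distance from a sequence escaping to infinity, seen from bounded points,
have the same asymptotic direction. -/
theorem tendsto_inv_norm_smul_sub {E : Type*} [NormedAddCommGroup E] [NormedSpace ℝ E]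
    {s q p : ℕ → E} {y : E} {R : ℝ} (hs : Tendsto (fun n => ‖s n‖) atTop atTop)
    (hsy : Tendsto (fun n => ‖s n‖⁻¹ • s n) atTop (nhds y))
    (hR : ∀ n, ‖q n - p n - s n‖ ≤ R) :
    Tendsto (fun n => ‖s n‖⁻¹ • (q n - p n)) atTop (nhds y) := by
  have hzero : Tendsto (fun n => ‖s n‖⁻¹ • (q n - p n - s n)) atTop (nhds 0) := by
    refine squeeze_zero_norm (a := fun n => ‖s n‖⁻¹ * R) (fun n => ?_) ?_
    · rw [norm_smul, norm_inv, norm_norm]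
      gcongr
      exact hR n
    · simpa using (tendsto_inv_atTop_zero.comp hs).mul_const R
  refine (by simpa using hsy.add hzero : Tendsto _ _ (nhds y)).congr fun n => ?_
  rw [← smul_add, add_sub_cancel]

/-- Let the colors be split into `k` colors with linearly independent limiting directions `y` and
the remaining colors `ι`. If every colorful selection has a `k`-flat transversal, then every
selection `c` from the colors in `ι` has a transversal parallel to the span of `y`. -/
theorem exists_mem_sub_mem_span_of_transversal {d k : ℕ} {ι : Type*} [Fintype ι] [Nonempty ι]
    {𝓐 : Fin k → Set (Set (EuclideanSpace ℝ (Fin d)))} {R : ℝ}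
    (hcpt : ∀ i, ∀ C ∈ 𝓐 i, IsCompact C) (hR : ∀ i, ∀ C ∈ 𝓐 i, diam C ≤ R)
    {y : Fin k → EuclideanSpace ℝ (Fin d)} (hy : ∀ i, y i ∈ LDS (𝓐 i))
    (hli : LinearIndependent ℝ y) {c : ι → Set (EuclideanSpace ℝ (Fin d))}
    (hc : ∀ i, IsCompact (c i))
    (h : ∀ C : Fin k → Set (EuclideanSpace ℝ (Fin d)), (∀ i, C i ∈ 𝓐 i) →
      ∃ H : AffineSubspace ℝ (EuclideanSpace ℝ (Fin d)), IsKFlat k H ∧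
        (∀ i, ((H : Set (EuclideanSpace ℝ (Fin d))) ∩ C i).Nonempty) ∧
        ∀ i, ((H : Set (EuclideanSpace ℝ (Fin d))) ∩ c i).Nonempty) :
    ∃ p : ι → EuclideanSpace ℝ (Fin d), (∀ i, p i ∈ c i) ∧
      ∀ i j, p i - p j ∈ Submodule.span ℝ (Set.range y) := by
  choose _ S s hS _ hs hsinf hsy using hy
  choose H hH hHS hHc using fun n => h (fun i => S i n) fun i => hS i n
  choose q hqH hqS using hHS
  choose p hpH hpc using hHc
  obtain ⟨p₀, hp₀, φ, hφ, hlim⟩ := (isCompact_univ_pi hc).tendsto_subseq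
    (x := p) fun n i _ => hpc n i
  rw [tendsto_pi_nhds] at hlim
  refine ⟨p₀, fun i => hp₀ i trivial, fun i j => ?_⟩
  obtain ⟨M, hM⟩ := isBounded_iff_forall_norm_le.1 (hc j).isBounded
  refine mem_span_range_of_tendsto hli (W := fun n => (H (φ n)).direction)
    (v := fun n l => ‖s l (φ n)‖⁻¹ • (q (φ n) l - p (φ n) j))
    (w := fun n => p (φ n) i - p (φ n) j)
    (fun n => (hH (φ n)).2.le) (fun n l => Submodule.smul_mem _ _ ?_) (fun l => ?_)
    (fun n => ?_) ((hlim i).sub (hlim j))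
  · exact AffineSubspace.vsub_mem_direction (hqH _ _) (hpH _ _)
  · refine (tendsto_inv_norm_smul_sub (q := fun n => q n l) (p := fun n => p n j) (R := R + M)
      (hsinf l) (hsy l) fun n => ?_).comp hφ.tendsto_atTop
    have h₁ : dist (q n l) (s l n) ≤ R :=
      (dist_le_diam_of_mem (hcpt l _ (hS l n)).isBounded (hqS n l) (hs l n)).trans
        (hR l _ (hS l n))
    rw [dist_eq_norm] at h₁
    rw [sub_right_comm]
    exact (norm_sub_le _ _).trans (add_le_add h₁ (hM _ (hpc n j)))
  · exact AffineSubspace.vsub_mem_direction (hpH _ _) (hpH _ _)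

/-- **Colorful Helly theorem for k-flats.** If each of the `d+1` families of
compact convex sets with uniformly bounded diameter is `k`-unbounded and every
colorful `(d+1)`-tuple admits a `k`-flat transversal, then some family has a
`k`-flat transversal. -/
theorem colorful_helly_kflats {d k : ℕ} (hd : 1 ≤ d) (hk1 : 1 ≤ k) (hk : k ≤ d - 1)
    (𝓢 : Fin (d + 1) → Set (Set (EuclideanSpace ℝ (Fin d))))
    (hcc : ∀ i, ∀ C ∈ 𝓢 i, IsCompact C ∧ Convex ℝ C)
    (hub : ∀ i, KUnbounded k (𝓢 i))
    (hR : ∃ R > 0, ∀ i, ∀ C ∈ 𝓢 i, Metric.diam C < R)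
    (h : ∀ C : Fin (d + 1) → Set (EuclideanSpace ℝ (Fin d)), (∀ i, C i ∈ 𝓢 i) →
      ∃ H : AffineSubspace ℝ (EuclideanSpace ℝ (Fin d)), IsKFlat k H ∧
        ∀ i, ((H : Set (EuclideanSpace ℝ (Fin d))) ∩ C i).Nonempty) :
    ∃ (j : Fin (d + 1)) (H : AffineSubspace ℝ (EuclideanSpace ℝ (Fin d))),
      IsKFlat k H ∧ ∀ C ∈ 𝓢 j, ((H : Set (EuclideanSpace ℝ (Fin d))) ∩ C).Nonempty := by
  classical
  obtain ⟨R, -, hR⟩ := hR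
  let e : Fin k ⊕ Fin (d - k + 1) ≃ Fin (d + 1) :=
    finSumFinEquiv.trans (finCongr (by omega))
  obtain ⟨y, hy, hli⟩ := exists_linearIndependent_mem_of_le_finrank_span
    (fun i => LDS (𝓢 (e (.inl i)))) fun i => hub _
  let V := Submodule.span ℝ (Set.range y)
  have hV : Module.finrank ℝ V = k := by simpa using finrank_span_eq_card hli
  let π := Vᗮ.orthogonalProjectionOnto
  have hπ : ∀ x, π x = 0 ↔ x ∈ V := fun x => by
    rw [Submodule.orthogonalProjectionOnto_eq_zero_iff, Submodule.orthogonal_orthogonal]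
  obtain ⟨j, x, hx⟩ := colorful_helly (ι := Fin (d - k + 1)) (F := Vᗮ)
    (T := fun i => (fun C => π '' C) '' 𝓢 (e (.inr i)))
    (by
      have := V.finrank_add_finrank_orthogonal
      rw [hV, finrank_euclideanSpace_fin] at this
      rw [Fintype.card_fin]
      omega)
    (by
      rintro i _ ⟨C, hC, rfl⟩
      exact ⟨(hcc _ C hC).1.image π.continuous, (hcc _ C hC).2.linear_image π.toLinearMap⟩)
    (by
      intro T hT
      choose c hc hcT using hT
      obtain ⟨p, hp, hpV⟩ := exists_mem_sub_mem_span_of_transversal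
        (fun i C hC => (hcc _ C hC).1) (fun i C hC => (hR _ C hC).le) hy hli
        (fun i => (hcc _ _ (hc i)).1) fun C hC => by
          obtain ⟨H, hH, hHC⟩ := h (fun i => Sum.elim C c (e.symm i)) fun i => by
            obtain ⟨i | i, rfl⟩ := e.surjective i
            · simpa using hC i
            · simpa using hc i
          exact ⟨H, hH, fun i => by simpa using hHC (e (.inl i)),
            fun i => by simpa using hHC (e (.inr i))⟩
      refine ⟨π (p 0), Set.mem_iInter.2 fun i => ?_⟩
      rw [← hcT i]
      refine ⟨p i, hp i, ?_⟩
      rw [← sub_eq_zero, ← map_sub, hπ]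
      exact hpV i 0)
  refine ⟨e (.inr j), AffineSubspace.mk' (x : EuclideanSpace ℝ (Fin d)) V,
    ⟨⟨x, AffineSubspace.self_mem_mk' _ _⟩, by rw [AffineSubspace.direction_mk', hV]⟩,
    fun C hC => ?_⟩
  obtain ⟨z, hz, hzx⟩ := hx _ ⟨C, hC, rfl⟩
  refine ⟨z, ?_, hz⟩
  rw [SetLike.mem_coe, AffineSubspace.mem_mk', vsub_eq_sub, ← hπ, map_sub, hzx, sub_eq_zero]
  exact (Submodule.orthogonalProjectionOnto_mem_subspace_eq_self x).symm
end

section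
/- There exists a family 𝓕 of convex sets in ℝ³ such that: (1) there exists R > 0 with diam(C) < R for all C ∈ 𝓕; (2) 𝓕 is 1-unbounded; (3) any three convex sets in 𝓕 can be simultaneously intersected by a plane (a 2-dimensional affine subspace) passing through the origin; and (4) for every plane K in ℝ³ there exists a set C_K ∈ 𝓕 with d(K, C_K) > 1. In particular, the 1-unboundedness hypothesis in the dimension independent Helly theorem for k-flats cannot be weakened: the family 𝓕 is 1-unbounded but no single plane lies within distance 1 of all sets of 𝓕, even though every triple of sets is pierced by a plane through the origin. -/
open Metric Filter

open scoped RealInnerProductSpace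

/-- A set at distance at most `1` from a subset of a hyperplane has points at distance less than `2`
from that hyperplane. -/
theorem exists_abs_inner_sub_lt_of_setDist_le {d : ℕ} {K C : Set (EuclideanSpace ℝ (Fin d))}
    {a : EuclideanSpace ℝ (Fin d)} {b : ℝ} (ha : ‖a‖ = 1) (hK : K.Nonempty)
    (hab : ∀ q ∈ K, ⟪a, q⟫ = b) (hC : C.Nonempty) (h : setDist K C ≤ 1) :
    ∃ p ∈ C, |⟪a, p⟫ - b| < 2 := by
  obtain ⟨q₀, hq₀⟩ := hK
  obtain ⟨p₀, hp₀⟩ := hC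
  obtain ⟨r, ⟨q, hq, p, hp, rfl⟩, hr⟩ :=
    exists_lt_of_csInf_lt (s := {r : ℝ | ∃ p₁ ∈ K, ∃ p₂ ∈ C, r = ‖p₁ - p₂‖})
      ⟨_, q₀, hq₀, p₀, hp₀, rfl⟩ (lt_of_le_of_lt h one_lt_two)
  refine ⟨p, hp, lt_of_le_of_lt ?_ hr⟩
  rw [← hab q hq, ← inner_sub_right, norm_sub_rev]
  simpa [ha] using abs_real_inner_le_norm a (p - q)

theorem IsKFlat.exists_unit_normal {K : AffineSubspace ℝ (EuclideanSpace ℝ (Fin 3))}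
    (hK : IsKFlat 2 K) :
    ∃ (a : EuclideanSpace ℝ (Fin 3)) (b : ℝ), ‖a‖ = 1 ∧ ∀ q ∈ K, ⟪a, q⟫ = b := by
  obtain ⟨⟨q₀, hq₀⟩, hfin⟩ := hK
  have hpos : 0 < Module.finrank ℝ K.directionᗮ := by
    have := K.direction.finrank_add_finrank_orthogonal
    simp only [hfin, finrank_euclideanSpace, Fintype.card_fin] at this
    omega
  have := Module.nontrivial_of_finrank_pos hpos
  obtain ⟨⟨a, ha⟩, hnorm⟩ := exists_norm_eq (K.directionᗮ) zero_le_one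
  refine ⟨a, ⟪a, q₀⟫, hnorm, fun q hq => ?_⟩
  rw [← sub_eq_zero, ← inner_sub_right]
  exact K.direction.inner_left_of_mem_orthogonal (AffineSubspace.vsub_mem_direction hq hq₀) ha

theorem exists_plane_through_zero {a : EuclideanSpace ℝ (Fin 3)} (ha : a ≠ 0) :
    ∃ K : AffineSubspace ℝ (EuclideanSpace ℝ (Fin 3)), IsKFlat 2 K ∧ 0 ∈ K ∧
      ∀ p, ⟪a, p⟫ = 0 → p ∈ K := by
  have : Fact (Module.finrank ℝ (EuclideanSpace ℝ (Fin 3)) = 2 + 1) := ⟨by simp⟩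
  refine ⟨(ℝ ∙ a)ᗮ.toAffineSubspace, ⟨⟨0, Submodule.zero_mem _⟩, ?_⟩, Submodule.zero_mem _,
    fun p hp => Submodule.mem_orthogonal_singleton_iff_inner_right.2 hp⟩
  rw [Submodule.toAffineSubspace_direction]
  exact Submodule.finrank_orthogonal_span_singleton ha

theorem inner_mem_Icc_of_mem_segment {E : Type*} [NormedAddCommGroup E] [InnerProductSpace ℝ E]
    (a : E) {p q x : E} (hx : x ∈ segment ℝ p q) :
    min ⟪a, p⟫ ⟪a, q⟫ ≤ ⟪a, x⟫ ∧ ⟪a, x⟫ ≤ max ⟪a, p⟫ ⟪a, q⟫ := by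
  rw [← Set.mem_Icc, ← Set.uIcc, ← segment_eq_uIcc]
  exact image_segment ℝ (innerₛₗ ℝ a).toAffineMap p q ▸ Set.mem_image_of_mem _ hx

/-- The vertices of a polygonal path around half of the origin in the horizontal plane. -/
noncomputable def pathVertex : Fin 4 → EuclideanSpace ℝ (Fin 3) :=
  ![!₂[100, 0, 0], !₂[0, 100, 0], !₂[-100, 100, 0], !₂[-100, 0, 0]]

/-- The sides of the polygonal path with vertices `pathVertex`. -/
noncomputable def pathSide (i : Fin 3) : Set (EuclideanSpace ℝ (Fin 3)) :=
  segment ℝ (pathVertex i.castSucc) (pathVertex i.succ)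

/-- The points with natural height on the vertical axis. -/
noncomputable def axisPoint (n : ℕ) : EuclideanSpace ℝ (Fin 3) := !₂[0, 0, (n : ℝ)]

/-- The singletons of the axis points together with the sides of the path. -/
def axisPathFamily : Set (Set (EuclideanSpace ℝ (Fin 3))) :=
  Set.range (fun n => {axisPoint n}) ∪ Set.range pathSide

/-- Normal vectors of four planes, each of which misses one kind of member of the family. -/
noncomputable def planeNormal : Fin 4 → EuclideanSpace ℝ (Fin 3) :=
  ![!₂[0, 0, 1], !₂[1, 1, 0], !₂[0, 1, 0], !₂[1, 0, 0]]

theorem planeNormal_ne_zero (m : Fin 4) : planeNormal m ≠ 0 := by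
  intro h
  have h0 := congrArg (fun v => v 0) h
  have h1 := congrArg (fun v => v 1) h
  have h2 := congrArg (fun v => v 2) h
  fin_cases m <;> simp [planeNormal] at h0 h1 h2

theorem exists_forall_ne_inner_planeNormal_eq_zero {C : Set (EuclideanSpace ℝ (Fin 3))}
    (hC : C ∈ axisPathFamily) :
    ∃ i : Fin 4, ∀ m ≠ i, ∃ p ∈ C, ⟪planeNormal m, p⟫ = 0 := by
  rcases hC with ⟨n, rfl⟩ | ⟨i, rfl⟩
  · refine ⟨0, fun m hm => ⟨axisPoint n, rfl, ?_⟩⟩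
    fin_cases m <;> simp_all [planeNormal, axisPoint, PiLp.inner_apply, Fin.sum_univ_three]
  · refine ⟨i.succ, fun m hm => ?_⟩
    suffices ⟪planeNormal m, pathVertex i.castSucc⟫ = 0 ∨ ⟪planeNormal m, pathVertex i.succ⟫ = 0
      from this.elim (fun h => ⟨_, left_mem_segment ℝ _ _, h⟩)
        (fun h => ⟨_, right_mem_segment ℝ _ _, h⟩)
    fin_cases i <;> fin_cases m <;>
      simp_all [planeNormal, pathVertex, PiLp.inner_apply, Fin.sum_univ_three]

theorem convex_of_mem_axisPathFamily {C : Set (EuclideanSpace ℝ (Fin 3))}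
    (hC : C ∈ axisPathFamily) : Convex ℝ C := by
  rcases hC with ⟨n, rfl⟩ | ⟨i, rfl⟩
  · exact convex_singleton _
  · exact convex_segment _ _

theorem nonempty_of_mem_axisPathFamily {C : Set (EuclideanSpace ℝ (Fin 3))}
    (hC : C ∈ axisPathFamily) : C.Nonempty := by
  rcases hC with ⟨n, rfl⟩ | ⟨i, rfl⟩
  · exact Set.singleton_nonempty _
  · exact ⟨_, left_mem_segment ℝ _ _⟩

theorem exists_diam_lt_of_mem_axisPathFamily :
    ∃ R > 0, ∀ C ∈ axisPathFamily, Metric.diam C < R := by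
  have hsum : 0 ≤ ∑ i, Metric.diam (pathSide i) := Finset.sum_nonneg fun _ _ => diam_nonneg
  refine ⟨(∑ i, Metric.diam (pathSide i)) + 1, by linarith, ?_⟩
  rintro C (⟨n, rfl⟩ | ⟨i, rfl⟩)
  · rw [Metric.diam_singleton]
    linarith
  · have := Finset.single_le_sum (f := fun i => Metric.diam (pathSide i))
      (fun _ _ => diam_nonneg) (Finset.mem_univ i)
    linarith

theorem norm_axisPoint (n : ℕ) : ‖axisPoint n‖ = n := by
  simp [axisPoint, EuclideanSpace.norm_eq, Fin.sum_univ_three]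

theorem kUnbounded_axisPathFamily : KUnbounded 1 axisPathFamily := by
  have hlim : axisPoint 1 ∈ LDS axisPathFamily := by
    refine ⟨by simp [norm_axisPoint], fun n => {axisPoint (n + 1)}, fun n => axisPoint (n + 1),
      fun n => Or.inl ⟨n + 1, rfl⟩, fun m n hmn h => hmn ?_, fun n => rfl, ?_, ?_⟩
    · have := congrArg norm (Set.singleton_injective h)
      simpa [norm_axisPoint] using this
    · simp only [norm_axisPoint]
      exact tendsto_natCast_atTop_atTop.comp (tendsto_add_atTop_nat 1)
    · refine tendsto_const_nhds.congr fun n => ?_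
      have : (n : ℝ) + 1 ≠ 0 := by positivity
      ext i
      fin_cases i <;> simp [norm_axisPoint] <;> simp [axisPoint, this]
  rw [KUnbounded, Submodule.one_le_finrank_iff, Ne, Submodule.span_eq_bot]
  intro h
  simpa [h _ hlim] using norm_axisPoint 1

theorem exists_one_lt_setDist_axisPathFamily
    {K : AffineSubspace ℝ (EuclideanSpace ℝ (Fin 3))} (hK : IsKFlat 2 K) :
    ∃ C ∈ axisPathFamily, 1 < setDist (K : Set (EuclideanSpace ℝ (Fin 3))) C := by
  by_contra! hclose
  obtain ⟨a, b, ha, hab⟩ := hK.exists_unit_normal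
  have hnear : ∀ C ∈ axisPathFamily, ∃ p ∈ C, |⟪a, p⟫ - b| < 2 := fun C hC =>
    exists_abs_inner_sub_lt_of_setDist_le ha hK.1 hab (nonempty_of_mem_axisPathFamily hC)
      (hclose C hC)
  have haxis (n : ℕ) : |n * a 2 - b| < 2 := by
    obtain ⟨p, rfl, hp⟩ := hnear _ (Or.inl ⟨n, rfl⟩)
    simpa [axisPoint, PiLp.inner_apply, Fin.sum_univ_three] using hp
  have hb := abs_lt.1 (haxis 0)
  have ha2 : a 2 = 0 := by
    by_contra hne
    obtain ⟨n, hn⟩ := exists_nat_gt (4 / |a 2|)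
    rw [div_lt_iff₀ (abs_pos.2 hne)] at hn
    have h1 := abs_sub_abs_le_abs_sub (n * a 2) b
    rw [abs_mul, Nat.abs_cast] at h1
    have h2 := haxis n
    have h3 : |b| < 2 := by simpa using haxis 0
    linarith
  have hsq : a 0 ^ 2 + a 1 ^ 2 = 1 := by
    have := EuclideanSpace.real_norm_sq_eq a
    simp [ha, Fin.sum_univ_three, ha2] at this
    linarith
  have hside (i : Fin 3) :
      min ⟪a, pathVertex i.castSucc⟫ ⟪a, pathVertex i.succ⟫ < 4 ∧
        -4 < max ⟪a, pathVertex i.castSucc⟫ ⟪a, pathVertex i.succ⟫ := by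
    obtain ⟨p, hp, hpb⟩ := hnear _ (Or.inr ⟨i, rfl⟩)
    have hmem := inner_mem_Icc_of_mem_segment a hp
    rw [abs_lt] at hpb
    simp only [CharP.cast_eq_zero, zero_mul] at hb
    exact ⟨by linarith, by linarith⟩
  have h0 := hside 0
  have h1 := hside 1
  have h2 := hside 2
  simp [pathVertex, PiLp.inner_apply, Fin.sum_univ_three] at h0 h1 h2
  rcases h0 with ⟨h0 | h0, h0' | h0'⟩ <;> rcases h1 with ⟨h1 | h1, h1' | h1'⟩ <;>
    rcases h2 with ⟨h2 | h2, h2' | h2'⟩ <;> nlinarith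

/-- **Necessity of k-unboundedness.** There is a family `𝓕` of convex sets in
`ℝ³` of uniformly bounded diameter that is `1`-unbounded, such that any three
members of `𝓕` are pierced by a plane (2-flat) through the origin, yet every
plane in `ℝ³` is at distance greater than `1` from some member of `𝓕`. -/
theorem not_k_unbounded_counterexample :
    ∃ 𝓕 : Set (Set (EuclideanSpace ℝ (Fin 3))),
      (∀ C ∈ 𝓕, Convex ℝ C) ∧
      (∃ R > 0, ∀ C ∈ 𝓕, Metric.diam C < R) ∧
      KUnbounded 1 𝓕 ∧
      (∀ C₁ ∈ 𝓕, ∀ C₂ ∈ 𝓕, ∀ C₃ ∈ 𝓕,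
        ∃ K : AffineSubspace ℝ (EuclideanSpace ℝ (Fin 3)), IsKFlat 2 K ∧
          (0 : EuclideanSpace ℝ (Fin 3)) ∈ K ∧
          ((K : Set (EuclideanSpace ℝ (Fin 3))) ∩ C₁).Nonempty ∧
          ((K : Set (EuclideanSpace ℝ (Fin 3))) ∩ C₂).Nonempty ∧
          ((K : Set (EuclideanSpace ℝ (Fin 3))) ∩ C₃).Nonempty) ∧
      (∀ K : AffineSubspace ℝ (EuclideanSpace ℝ (Fin 3)), IsKFlat 2 K →
        ∃ C ∈ 𝓕, 1 < setDist (K : Set (EuclideanSpace ℝ (Fin 3))) C) := by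
  refine ⟨axisPathFamily, fun _ => convex_of_mem_axisPathFamily,
    exists_diam_lt_of_mem_axisPathFamily, kUnbounded_axisPathFamily, ?_,
    fun _ => exists_one_lt_setDist_axisPathFamily⟩
  intro C₁ h₁ C₂ h₂ C₃ h₃
  obtain ⟨i₁, hi₁⟩ := exists_forall_ne_inner_planeNormal_eq_zero h₁
  obtain ⟨i₂, hi₂⟩ := exists_forall_ne_inner_planeNormal_eq_zero h₂
  obtain ⟨i₃, hi₃⟩ := exists_forall_ne_inner_planeNormal_eq_zero h₃
  obtain ⟨m, hm₁, hm₂, hm₃⟩ : ∃ m, m ≠ i₁ ∧ m ≠ i₂ ∧ m ≠ i₃ := by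
    clear hi₁ hi₂ hi₃
    decide +revert
  obtain ⟨K, hK, hK0, hKmem⟩ := exists_plane_through_zero (planeNormal_ne_zero m)
  obtain ⟨p₁, hp₁, e₁⟩ := hi₁ m hm₁
  obtain ⟨p₂, hp₂, e₂⟩ := hi₂ m hm₂
  obtain ⟨p₃, hp₃, e₃⟩ := hi₃ m hm₃
  exact ⟨K, hK, hK0, ⟨p₁, hKmem _ e₁, hp₁⟩, ⟨p₂, hKmem _ e₂, hp₂⟩, ⟨p₃, hKmem _ e₃, hp₃⟩⟩
end

section
/- There exist families 𝓕₁, 𝓕₂, 𝓕₃ of convex sets in ℝ³ satisfying all of the following: (1) every C ∈ 𝓕₁ ∪ 𝓕₂ ∪ 𝓕₃ has diam(C) = √2; (2) both 𝓕₁ and 𝓕₂ are 1-unbounded; (3) for every triple (C₁, C₂, C₃) ∈ 𝓕₁ × 𝓕₂ × 𝓕₃ there exists a line L that intersects C₁, C₂ and C₃ and satisfies d(L, 0) ≤ 1, where 0 is the origin; and (4) for every line K in ℝ³ there exists j ∈ {1, 2, 3} such that sup_{C ∈ 𝓕ⱼ} d(C, K) ≥ 1/√2. In particular, the bound √(1/(r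 − k)) in the dimension independent colorful Helly theorem for k-flats is tight for r = 3 and k = 1. -/
open Metric Filter

section NormedSpace

variable {E : Type*} [NormedAddCommGroup E] [NormedSpace ℝ E]

lemma tendsto_norm_add_natCast_smul (w : E) {e : E} (he : ‖e‖ = 1) :
    Tendsto (fun n : ℕ => ‖w + (n : ℝ) • e‖) atTop atTop := by
  refine tendsto_atTop_mono (fun n => ?_)
    (tendsto_atTop_add_const_right atTop (-‖w‖) (tendsto_natCast_atTop_atTop (R := ℝ)))
  have h := norm_sub_le (w + (n : ℝ) • e) w
  rw [add_sub_cancel_left, norm_smul, he, Real.norm_natCast] at h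
  linarith

lemma tendsto_normalize_add_natCast_smul (w : E) {e : E} (he : ‖e‖ = 1) :
    Tendsto (fun n : ℕ => ‖w + (n : ℝ) • e‖⁻¹ • (w + (n : ℝ) • e)) atTop (nhds e) := by
  have h1 : Tendsto (fun n : ℕ => (n : ℝ)⁻¹ • w + e) atTop (nhds e) := by
    simpa using ((tendsto_inv_atTop_nhds_zero_nat (𝕜 := ℝ)).smul_const w).add_const e
  have h2 : Tendsto (fun n : ℕ => ‖(n : ℝ)⁻¹ • w + e‖⁻¹ • ((n : ℝ)⁻¹ • w + e)) atTop (nhds e) := by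
    simpa [he] using (h1.norm.inv₀ (by simp [he])).smul h1
  refine h2.congr' ?_
  filter_upwards [eventually_gt_atTop 0] with n hn
  have hn' : (0 : ℝ) < n := by exact_mod_cast hn
  have h3 : (n : ℝ)⁻¹ • w + e = (n : ℝ)⁻¹ • (w + (n : ℝ) • e) := by
    rw [smul_add, smul_smul, inv_mul_cancel₀ hn'.ne', one_smul]
  rw [h3, norm_smul, norm_inv, Real.norm_natCast, mul_inv, inv_inv, smul_smul]
  congr 1
  field_simp

lemma diam_segment (a b : E) : Metric.diam (segment ℝ a b) = dist a b := by
  rw [← convexHull_pair, convexHull_diam, Metric.diam_pair]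

end NormedSpace

lemma kUnbounded_one_of_isLimitingDirection {d : ℕ}
    {𝓕 : Set (Set (EuclideanSpace ℝ (Fin d)))} {y : EuclideanSpace ℝ (Fin d)}
    (h : IsLimitingDirection 𝓕 y) : KUnbounded 1 𝓕 := by
  have hy : y ≠ 0 := by
    rintro rfl
    simpa using h.1
  unfold KUnbounded
  rw [← finrank_span_singleton (K := ℝ) hy]
  exact Submodule.finrank_mono (Submodule.span_mono (Set.singleton_subset_iff.2 h))

lemma le_setDist {d : ℕ} {S T : Set (EuclideanSpace ℝ (Fin d))} {c : ℝ}
    (hS : S.Nonempty) (hT : T.Nonempty) (h : ∀ p ∈ S, ∀ q ∈ T, c ≤ ‖p - q‖) :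
    c ≤ setDist S T := by
  obtain ⟨p, hp⟩ := hS
  obtain ⟨q, hq⟩ := hT
  refine le_csInf ⟨_, p, hp, q, hq, rfl⟩ ?_
  rintro _ ⟨p, hp, q, hq, rfl⟩
  exact h p hp q hq

/-- The segment of length `√2` parallel to the first axis, centred at `(0, t, z)`. -/
noncomputable def xSegment (t z : ℝ) : Set (EuclideanSpace ℝ (Fin 3)) :=
  segment ℝ !₂[-(√2 / 2), t, z] !₂[√2 / 2, t, z]

/-- The segment of length `√2` parallel to the second axis, centred at `(0, 0, z)`. -/
noncomputable def ySegment (z : ℝ) : Set (EuclideanSpace ℝ (Fin 3)) :=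
  segment ℝ !₂[0, -(√2 / 2), z] !₂[0, √2 / 2, z]

lemma mem_xSegment {t z : ℝ} {x : EuclideanSpace ℝ (Fin 3)} :
    x ∈ xSegment t z → |x 0| ≤ √2 / 2 ∧ x 1 = t ∧ x 2 = z := by
  rintro ⟨a, b, ha, hb, hab, rfl⟩
  have h2 : 0 ≤ √2 := Real.sqrt_nonneg 2
  obtain rfl : b = 1 - a := by linarith
  refine ⟨?_, ?_, ?_⟩
  · simp only [PiLp.add_apply, PiLp.smul_apply, smul_eq_mul, Matrix.cons_val_zero]
    rw [abs_le]
    constructor <;> nlinarith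
  · simp
    ring
  · simp
    ring

lemma mem_ySegment {z : ℝ} {x : EuclideanSpace ℝ (Fin 3)} :
    x ∈ ySegment z → x 2 = z := by
  rintro ⟨a, b, ha, hb, hab, rfl⟩
  obtain rfl : b = 1 - a := by linarith
  simp
  ring

lemma diam_xSegment (t z : ℝ) : Metric.diam (xSegment t z) = √2 := by
  rw [xSegment, diam_segment, EuclideanSpace.dist_eq]
  simp [Fin.sum_univ_three, Real.dist_eq]
  rw [Real.sqrt_sq_eq_abs, abs_of_nonpos] <;> linarith [Real.sqrt_nonneg 2]

lemma diam_ySegment (z : ℝ) : Metric.diam (ySegment z) = √2 := by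
  rw [ySegment, diam_segment, EuclideanSpace.dist_eq]
  simp [Fin.sum_univ_three, Real.dist_eq]
  rw [Real.sqrt_sq_eq_abs, abs_of_nonpos] <;> linarith [Real.sqrt_nonneg 2]

/-- The unit vector along the third axis. -/
noncomputable def zAxis : EuclideanSpace ℝ (Fin 3) := !₂[0, 0, 1]

lemma norm_zAxis : ‖zAxis‖ = 1 := by
  simp [zAxis, EuclideanSpace.norm_eq, Fin.sum_univ_three]

lemma kUnbounded_one_of_heights {𝓕 : Set (Set (EuclideanSpace ℝ (Fin 3)))}
    (S : ℕ → Set (EuclideanSpace ℝ (Fin 3))) (w : EuclideanSpace ℝ (Fin 3))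
    (hS : ∀ n, S n ∈ 𝓕) (hz : ∀ n, ∀ x ∈ S n, x 2 = n)
    (hw : ∀ n : ℕ, w + (n : ℝ) • zAxis ∈ S n) : KUnbounded 1 𝓕 := by
  refine kUnbounded_one_of_isLimitingDirection (y := zAxis)
    ⟨norm_zAxis, S, fun n => w + (n : ℝ) • zAxis, hS, fun m n hmn h => hmn ?_, hw,
      tendsto_norm_add_natCast_smul w norm_zAxis, tendsto_normalize_add_natCast_smul w norm_zAxis⟩
  have h1 := hz m _ (hw m)
  have h2 := hz n _ (h ▸ hw m)
  exact Nat.cast_injective (R := ℝ) (h1.symm.trans h2)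

/-- The line parallel to the third axis through `(0, t, 0)`. -/
noncomputable def verticalLine (t : ℝ) : AffineSubspace ℝ (EuclideanSpace ℝ (Fin 3)) :=
  AffineSubspace.mk' !₂[0, t, 0] (Submodule.span ℝ {zAxis})

lemma mem_verticalLine (t z : ℝ) : !₂[0, t, z] ∈ verticalLine t := by
  rw [verticalLine, AffineSubspace.mem_mk', Submodule.mem_span_singleton]
  refine ⟨z, ?_⟩
  ext i
  fin_cases i <;> simp [zAxis]

lemma isKFlat_verticalLine (t : ℝ) : IsKFlat 1 (verticalLine t) := by
  refine ⟨⟨_, mem_verticalLine t 0⟩, ?_⟩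
  rw [verticalLine, AffineSubspace.direction_mk', finrank_span_singleton]
  intro h
  simpa [h] using norm_zAxis

lemma mem_xSegment_mid (t z : ℝ) : !₂[0, t, z] ∈ xSegment t z := by
  refine ⟨1 / 2, 1 / 2, by norm_num, by norm_num, by norm_num, ?_⟩
  ext i
  fin_cases i <;> simp <;> ring

lemma mem_ySegment_endpoint {t : ℝ} (ht : t = √2 / 2 ∨ t = -(√2 / 2)) (z : ℝ) :
    !₂[0, t, z] ∈ ySegment z := by
  rcases ht with rfl | rfl
  · exact right_mem_segment ℝ _ _
  · exact left_mem_segment ℝ _ _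

/-- Points at a great height are far from a line whose direction is not vertical. -/
lemma exists_height_one_le_norm_sub (p v : EuclideanSpace ℝ (Fin 3)) {i : Fin 3} (hv : v i ≠ 0) :
    ∃ n : ℕ, ∀ x : EuclideanSpace ℝ (Fin 3), |x i| ≤ 1 → x 2 = n →
      ∀ r : ℝ, 1 ≤ ‖x - (r • v + p)‖ := by
  have hv' : 0 < |v i| := abs_pos.2 hv
  obtain ⟨n, hn⟩ := exists_nat_gt ((|v i| + 2 * |v 2| + |v i * p 2 - v 2 * p i|) / |v i|)
  rw [div_lt_iff₀ hv'] at hn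
  refine ⟨n, fun x hx hxn r => ?_⟩
  set u := x - (r • v + p) with hu
  have hui : |u i| ≤ ‖u‖ := PiLp.norm_apply_le u i
  have hu2 : |u 2| ≤ ‖u‖ := PiLp.norm_apply_le u 2
  have key : v i * n = v i * u 2 - v 2 * u i + v 2 * x i + (v i * p 2 - v 2 * p i) := by
    simp only [hu, PiLp.sub_apply, PiLp.add_apply, PiLp.smul_apply, smul_eq_mul, hxn]
    ring
  have h1 : |v i| * n ≤ |v i| * |u 2| + |v 2| * |u i| + |v 2| * |x i|
      + |v i * p 2 - v 2 * p i| := by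
    rw [← abs_mul, ← abs_mul, ← abs_mul, ← Nat.abs_cast n, ← abs_mul, key]
    exact (abs_add_le _ _).trans (add_le_add_left ((abs_add_le _ _).trans
      (add_le_add_left (abs_sub _ _) _)) _)
  have h2 : |v 2| * |x i| ≤ |v 2| := mul_le_of_le_one_right (abs_nonneg _) hx
  have h3 := mul_le_mul_of_nonneg_left hu2 (abs_nonneg (v i))
  have h4 := mul_le_mul_of_nonneg_left hui (abs_nonneg (v 2))
  by_contra! hlt
  nlinarith [abs_nonneg (v 2)]

lemma sqrt_two_div_two_le_one : √2 / 2 ≤ 1 := by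
  have := Real.sqrt_two_lt_three_halves
  linarith

lemma exists_le_setDist_xSegment {K : AffineSubspace ℝ (EuclideanSpace ℝ (Fin 3))}
    (hK : IsKFlat 1 K) :
    ∃ n : ℕ, ∃ t : ℝ, (t = √2 / 2 ∨ t = -(√2 / 2)) ∧
      √2 / 2 ≤ setDist (xSegment t n) (K : Set (EuclideanSpace ℝ (Fin 3))) := by
  obtain ⟨⟨p, hp⟩, hrank⟩ := hK
  obtain ⟨v, -, hv⟩ := finrank_eq_one_iff'.1 hrank
  have hline : ∀ q ∈ (K : Set (EuclideanSpace ℝ (Fin 3))),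
      ∃ r : ℝ, q = r • (v : EuclideanSpace ℝ (Fin 3)) + p := by
    intro q hq
    obtain ⟨r, hr⟩ := hv ⟨q - p, AffineSubspace.vsub_mem_direction hq hp⟩
    refine ⟨r, ?_⟩
    have := congrArg Subtype.val hr
    simp only [Submodule.coe_smul] at this
    rw [this, sub_add_cancel]
  have hs := sqrt_two_div_two_le_one
  have hne : ∀ t z, (xSegment t z).Nonempty := fun t z => ⟨_, mem_xSegment_mid t z⟩
  have hs0 : 0 ≤ √2 / 2 := by positivity
  by_cases h1 : (v : EuclideanSpace ℝ (Fin 3)) 1 = 0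
  · by_cases h0 : (v : EuclideanSpace ℝ (Fin 3)) 0 = 0
    · obtain ⟨t, ht, htp⟩ : ∃ t : ℝ, (t = √2 / 2 ∨ t = -(√2 / 2)) ∧ √2 / 2 ≤ |t - p 1| := by
        rcases le_total (p 1) 0 with h | h
        · exact ⟨_, Or.inl rfl, le_trans (by linarith) (le_abs_self _)⟩
        · exact ⟨_, Or.inr rfl, le_trans (by linarith) (neg_le_abs _)⟩
      refine ⟨0, t, ht, le_setDist (hne _ _) ⟨p, hp⟩ fun x hx q hq => ?_⟩
      obtain ⟨r, rfl⟩ := hline q hq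
      refine le_trans ?_ (PiLp.norm_apply_le _ 1)
      simpa [h1, (mem_xSegment hx).2.1] using htp
    · obtain ⟨n, hn⟩ := exists_height_one_le_norm_sub p v h0
      refine ⟨n, _, Or.inl rfl, le_setDist (hne _ _) ⟨p, hp⟩ fun x hx q hq => ?_⟩
      obtain ⟨r, rfl⟩ := hline q hq
      obtain ⟨hx0, -, hx2⟩ := mem_xSegment hx
      exact hs.trans (hn x (hx0.trans hs) hx2 r)
  · obtain ⟨n, hn⟩ := exists_height_one_le_norm_sub p v h1
    refine ⟨n, _, Or.inl rfl, le_setDist (hne _ _) ⟨p, hp⟩ fun x hx q hq => ?_⟩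
    obtain ⟨r, rfl⟩ := hline q hq
    obtain ⟨-, hx1, hx2⟩ := mem_xSegment hx
    refine hs.trans (hn x ?_ hx2 r)
    rwa [hx1, abs_of_nonneg hs0]

/-- **Tightness of the bound `√(1/(r-k))` for `r = 3`, `k = 1`.** There are
families `𝓕₁, 𝓕₂, 𝓕₃` of convex sets in `ℝ³`, all of diameter `√2`, with
`𝓕₁, 𝓕₂` `1`-unbounded, such that every colorful triple is pierced by a line
within distance `1` of the origin, yet for every line `K` some family `𝓕ⱼ`
satisfies `sup_{C ∈ 𝓕ⱼ} d(C, K) ≥ 1/√2` (the supremum condition is expressed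
by: every `b < 1/√2` is exceeded by `d(C, K)` for some `C ∈ 𝓕ⱼ`). -/
theorem tightness_counterexample :
    ∃ 𝓕₁ 𝓕₂ 𝓕₃ : Set (Set (EuclideanSpace ℝ (Fin 3))),
      (∀ C ∈ 𝓕₁ ∪ 𝓕₂ ∪ 𝓕₃, Convex ℝ C ∧ Metric.diam C = Real.sqrt 2) ∧
      KUnbounded 1 𝓕₁ ∧ KUnbounded 1 𝓕₂ ∧
      (∀ C₁ ∈ 𝓕₁, ∀ C₂ ∈ 𝓕₂, ∀ C₃ ∈ 𝓕₃,
        ∃ L : AffineSubspace ℝ (EuclideanSpace ℝ (Fin 3)), IsKFlat 1 L ∧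
          Metric.infDist (0 : EuclideanSpace ℝ (Fin 3))
            (L : Set (EuclideanSpace ℝ (Fin 3))) ≤ 1 ∧
          ((L : Set (EuclideanSpace ℝ (Fin 3))) ∩ C₁).Nonempty ∧
          ((L : Set (EuclideanSpace ℝ (Fin 3))) ∩ C₂).Nonempty ∧
          ((L : Set (EuclideanSpace ℝ (Fin 3))) ∩ C₃).Nonempty) ∧
      (∀ K : AffineSubspace ℝ (EuclideanSpace ℝ (Fin 3)), IsKFlat 1 K →
        ∃ 𝓕 ∈ ({𝓕₁, 𝓕₂, 𝓕₃} : Set (Set (Set (EuclideanSpace ℝ (Fin 3))))),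
          ∀ b < 1 / Real.sqrt 2, ∃ C ∈ 𝓕,
            b < setDist C (K : Set (EuclideanSpace ℝ (Fin 3)))) := by
  
  set 𝓨 : Set (Set (EuclideanSpace ℝ (Fin 3))) := Set.range fun n : ℕ => ySegment n with h𝓨
  set 𝓧 : Set (Set (EuclideanSpace ℝ (Fin 3))) :=
    {C | ∃ n : ℕ, ∃ t : ℝ, (t = √2 / 2 ∨ t = -(√2 / 2)) ∧ C = xSegment t n} with h𝓧
  have hsmul : ∀ (t : ℝ) (n : ℕ), !₂[0, t, 0] + (n : ℝ) • zAxis = !₂[0, t, (n : ℝ)] := by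
    intro t n
    ext i
    fin_cases i <;> simp [zAxis]
  refine ⟨𝓨, 𝓧, 𝓨, ?_, ?_, ?_, ?_, ?_⟩
  · rintro C ((⟨n, rfl⟩ | ⟨n, t, -, rfl⟩) | ⟨n, rfl⟩)
    · exact ⟨convex_segment _ _, diam_ySegment _⟩
    · exact ⟨convex_segment _ _, diam_xSegment _ _⟩
    · exact ⟨convex_segment _ _, diam_ySegment _⟩
  · refine kUnbounded_one_of_heights (fun n => ySegment n) !₂[0, √2 / 2, 0] (fun n => ⟨n, rfl⟩)
      (fun n x hx => mem_ySegment hx) fun n => ?_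
    rw [hsmul]
    exact mem_ySegment_endpoint (Or.inl rfl) _
  · refine kUnbounded_one_of_heights (fun n => xSegment (√2 / 2) n) !₂[0, √2 / 2, 0]
      (fun n => ⟨n, _, Or.inl rfl, rfl⟩) (fun n x hx => (mem_xSegment hx).2.2) fun n => ?_
    rw [hsmul]
    exact mem_xSegment_mid _ _
  · rintro _ ⟨m, rfl⟩ _ ⟨n, t, ht, rfl⟩ _ ⟨k, rfl⟩
    refine ⟨verticalLine t, isKFlat_verticalLine t, ?_,
      ⟨_, mem_verticalLine t m, mem_ySegment_endpoint ht m⟩,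
      ⟨_, mem_verticalLine t n, mem_xSegment_mid t n⟩,
      ⟨_, mem_verticalLine t k, mem_ySegment_endpoint ht k⟩⟩
    refine (Metric.infDist_le_dist_of_mem (mem_verticalLine t 0)).trans ?_
    have hs := sqrt_two_div_two_le_one
    have hs0 : 0 ≤ √2 / 2 := by positivity
    rw [dist_zero_left, EuclideanSpace.norm_eq]
    simp only [Fin.sum_univ_three, Real.norm_eq_abs, sq_abs]
    rcases ht with rfl | rfl <;> simpa [Real.sqrt_sq_eq_abs, abs_of_nonneg hs0] using hs
  · intro K hK
    obtain ⟨n, t, ht, hle⟩ := exists_le_setDist_xSegment hK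
    refine ⟨𝓧, by simp, fun b hb => ⟨_, ⟨n, t, ht, rfl⟩, lt_of_lt_of_le hb ?_⟩⟩
    rwa [one_div, ← Real.sqrt_div_self]
end

section
/- Let B₁, …, Bₘ be nonempty compact sets in ℝ^d, and let z₁, …, z_k ∈ ℝ^d be linearly independent vectors. Suppose that for every n ∈ ℕ there exist vectors z_{1,n}, …, z_{k,n} ∈ ℝ^d spanning a k-dimensional linear subspace Vₙ with z_{i,n} → z_i as n → ∞ for each i ∈ {1, …, k}, and there exists a k-flat Kₙ with direction space Vₙ such that Kₙ intersects Bⱼ for every j ∈ {1, …, m}. Then there exists a k-flat K whose direction space is the linear span of {z₁, …, z_k} such that K intersects Bⱼ for every j ∈ {1, …, m}. -/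
open Filter

/-- Membership in the span of a convergent family of vectors passes to the limit, provided the
limiting family is linearly independent. -/
theorem mem_span_range_of_tendsto_s11 {𝕜 E α ι : Type*} [NontriviallyNormedField 𝕜] [CompleteSpace 𝕜]
    [NormedAddCommGroup E] [NormedSpace 𝕜 E] [Finite ι] {l : Filter α} [l.NeBot]
    {v : α → ι → E} {v₀ : ι → E} (hv₀ : LinearIndependent 𝕜 v₀) (hv : Tendsto v l (nhds v₀))
    {w : α → E} {w₀ : E} (hw : Tendsto w l (nhds w₀))
    (hmem : ∀ a, w a ∈ Submodule.span 𝕜 (Set.range (v a))) :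
    w₀ ∈ Submodule.span 𝕜 (Set.range v₀) := by
  by_contra hw₀
  let extend (x : E) (y : ι → E) : Option ι → E := fun o => o.elim x y
  have hli : LinearIndependent 𝕜 (extend w₀ v₀) :=
    linearIndependent_option.mpr ⟨hv₀, hw₀⟩
  have hlim : Tendsto (fun a => extend (w a) (v a)) l (nhds (extend w₀ v₀)) := by
    rw [tendsto_pi_nhds]
    rintro (_ | i)
    · exact hw
    · exact tendsto_pi_nhds.mp hv i
  obtain ⟨a, ha⟩ := (hlim.eventually (isOpen_setOfPred_linearIndependent.mem_nhds hli)).exists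
  exact (linearIndependent_option.mp ha).2 (hmem a)

/-- **Compactness/limiting argument for flat transversals.** If nonempty compact
sets `B₁, …, Bₘ` admit, for every `n`, a common transversal `k`-flat whose
direction is spanned by vectors `z_{1,n}, …, z_{k,n}` (spanning a `k`-dimensional
subspace) converging to linearly independent vectors `z₁, …, z_k`, then they
admit a common transversal `k`-flat whose direction is the span of
`z₁, …, z_k`. -/
theorem flat_transversal_of_limiting_directions {d k m : ℕ}
    (B : Fin m → Set (EuclideanSpace ℝ (Fin d)))
    (hB : ∀ j, (B j).Nonempty ∧ IsCompact (B j))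
    (z : Fin k → EuclideanSpace ℝ (Fin d)) (hz : LinearIndependent ℝ z)
    (h : ∃ z' : ℕ → Fin k → EuclideanSpace ℝ (Fin d),
      (∀ i, Tendsto (fun n => z' n i) atTop (nhds (z i))) ∧
      ∀ n, Module.finrank ℝ (Submodule.span ℝ (Set.range (z' n))) = k ∧
        ∃ K : AffineSubspace ℝ (EuclideanSpace ℝ (Fin d)),
          K.direction = Submodule.span ℝ (Set.range (z' n)) ∧
          (K : Set (EuclideanSpace ℝ (Fin d))).Nonempty ∧
          ∀ j, ((K : Set (EuclideanSpace ℝ (Fin d))) ∩ B j).Nonempty) :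
    ∃ K : AffineSubspace ℝ (EuclideanSpace ℝ (Fin d)),
      K.direction = Submodule.span ℝ (Set.range z) ∧
      (K : Set (EuclideanSpace ℝ (Fin d))).Nonempty ∧
      ∀ j, ((K : Set (EuclideanSpace ℝ (Fin d))) ∩ B j).Nonempty := by
  obtain ⟨z', hz', h⟩ := h
  choose _ K hKdir _ hKB using h
  choose x hxK hxB using hKB
  rcases isEmpty_or_nonempty (Fin m) with hm | ⟨⟨j₀⟩⟩
  · exact ⟨AffineSubspace.mk' 0 _, AffineSubspace.direction_mk' _ _,
      AffineSubspace.mk'_nonempty _ _, fun j => hm.elim j⟩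
  obtain ⟨y, hyB, φ, hφ, hlim⟩ :=
    (isCompact_univ_pi fun j => (hB j).2).tendsto_subseq fun n => Set.mem_univ_pi.mpr (hxB n)
  refine ⟨AffineSubspace.mk' (y j₀) _, AffineSubspace.direction_mk' _ _,
    AffineSubspace.mk'_nonempty _ _, fun j => ⟨y j, ?_, hyB j (Set.mem_univ j)⟩⟩
  rw [SetLike.mem_coe, AffineSubspace.mem_mk']
  rw [tendsto_pi_nhds] at hlim
  refine mem_span_range_of_tendsto_s11 hz ((tendsto_pi_nhds.mpr hz').comp hφ.tendsto_atTop)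
    ((hlim j).sub (hlim j₀)) fun n => ?_
  have hdir := AffineSubspace.vsub_mem_direction (hxK (φ n) j) (hxK (φ n) j₀)
  rwa [hKdir] at hdir
end
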